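/- arXiv:0904.1479 — 3 statements merged into one kernel-verified Lean document; each statement's English description precedes it below -/
import Mathlib

section
/- For every integer d ≥ 2, the vertex Turán density of G_d equals 2/3; that is, λ(G_d) = lim_{n→∞} exc(n, G_d)/2^n = 2/3. -/
open Finset Filter Topology

/-- The weight of a vertex of the hypercube `{0,1}^n`: number of coordinates equal to 1. -/
def cubeWeight {n : ℕ} (x : Fin n → Bool) : ℕ :=
  (Finset.univ.filter fun i => x i = true).card

/-- The support of a vertex of the hypercube: the set of coordinates equal to 1. -/
def cubeSupp {n : ℕ} (x : Fin n → Bool) : Finset (Fin n) :=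
  Finset.univ.filter fun i => x i = true

/-- An embedding of the `d`-dimensional hypercube `Q_d` into `Q_n`: an injective map on
vertices that preserves the edges (pairs at Hamming distance 1). -/
def IsCubeEmbedding {d n : ℕ} (i : (Fin d → Bool) → (Fin n → Bool)) : Prop :=
  Function.Injective i ∧
    ∀ x y : Fin d → Bool, hammingDist x y = 1 → hammingDist (i x) (i y) = 1

/-- `S ⊆ V_n` is `F`-free (for `F ⊆ V_d`) if no embedding `i : Q_d → Q_n` has `i(F) ⊆ S`. -/
def IsFree {d n : ℕ} (F : Set (Fin d → Bool)) (S : Set (Fin n → Bool)) : Prop :=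
  ∀ i : (Fin d → Bool) → (Fin n → Bool), IsCubeEmbedding i → ¬ (i '' F ⊆ S)

/-- `exc n F`: the maximum size of an `F`-free subset of `V_n = {0,1}^n`. -/
noncomputable def exc {d : ℕ} (n : ℕ) (F : Set (Fin d → Bool)) : ℕ :=
  sSup {k : ℕ | ∃ S : Finset (Fin n → Bool), IsFree F (S : Set (Fin n → Bool)) ∧ S.card = k}

/-- The configuration G_d ⊆ V_d: all vertices of weight 0 or 1, together with all vertices of
weight 2 whose support {i,j} has i ≢ j (mod 2). -/
def Gconf (d : ℕ) : Set (Fin d → Bool) :=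
  {x | cubeWeight x = 0 ∨ cubeWeight x = 1 ∨
    (cubeWeight x = 2 ∧ ∃ i j : Fin d, (i : ℕ) % 2 ≠ (j : ℕ) % 2 ∧ cubeSupp x = {i, j})}

/-- Flip coordinate `a` of `x`. -/
def cflip {n : ℕ} (x : Fin n → Bool) (a : Fin n) : Fin n → Bool :=
  Function.update x a (!x a)

lemma cflip_apply {n : ℕ} (x : Fin n → Bool) (a m : Fin n) :
    cflip x a m = if m = a then !x m else x m := by
  unfold cflip
  by_cases h : m = a
  · subst h; simp
  · simp [h]

lemma cflip_cflip {n : ℕ} (x : Fin n → Bool) (a : Fin n) : cflip (cflip x a) a = x := by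
  ext m
  simp only [cflip_apply]
  split_ifs <;> simp

lemma cflip_comm {n : ℕ} (x : Fin n → Bool) (a b : Fin n) :
    cflip (cflip x a) b = cflip (cflip x b) a := by
  ext m
  simp only [cflip_apply]
  split_ifs <;> simp

/-- Flipping as an equivalence. -/
def cflipEquiv {n : ℕ} (a : Fin n) : (Fin n → Bool) ≃ (Fin n → Bool) where
  toFun x := cflip x a
  invFun x := cflip x a
  left_inv x := cflip_cflip x a
  right_inv x := cflip_cflip x a

lemma exists_cflip_of_dist {n : ℕ} {x y : Fin n → Bool} (h : hammingDist x y = 1) :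
    ∃ a, y = cflip x a := by
  unfold hammingDist at h
  obtain ⟨a, ha⟩ := Finset.card_eq_one.1 h
  refine ⟨a, ?_⟩
  funext m
  have hm : (x m ≠ y m) ↔ m = a := by
    have := Finset.ext_iff.1 ha m
    simpa using this
  rw [cflip_apply]
  by_cases hma : m = a
  · have := hm.2 hma
    simp only [hma, if_true] at *
    cases hx : x a <;> cases hy : y a <;> simp_all
  · have : ¬ (x m ≠ y m) := fun h => hma (hm.1 h)
    simp only [hma, if_false]
    exact (not_not.1 this).symm

lemma weight_cflip {n : ℕ} (x : Fin n → Bool) (a : Fin n) :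
    (cubeWeight (cflip x a) : ℤ) = cubeWeight x + (if x a = true then -1 else 1) := by
  have key : ∀ y : Fin n → Bool, (cubeWeight y : ℤ) =
      (if y a = true then 1 else 0) + ∑ i ∈ Finset.univ.erase a, (if y i = true then (1:ℤ) else 0) := by
    intro y
    unfold cubeWeight
    rw [Finset.card_filter]
    push_cast
    exact (Finset.add_sum_erase _ (fun i => if y i = true then (1:ℤ) else 0) (Finset.mem_univ a)).symm
  rw [key, key x]
  have : ∑ i ∈ Finset.univ.erase a, (if cflip x a i = true then (1:ℤ) else 0)
      = ∑ i ∈ Finset.univ.erase a, (if x i = true then (1:ℤ) else 0) := by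
    apply Finset.sum_congr rfl
    intro i hi
    rw [cflip_apply, if_neg (Finset.ne_of_mem_erase hi)]
  rw [this, cflip_apply]
  cases x a <;> simp [add_comm]

lemma cflip_inj {n : ℕ} {x : Fin n → Bool} {a b : Fin n} (h : cflip x a = cflip x b) : a = b := by
  by_contra hab
  have := congrFun h a
  rw [cflip_apply, cflip_apply, if_pos rfl, if_neg hab] at this
  cases hx : x a <;> simp_all

lemma square_struct {n : ℕ} {u : Fin n → Bool} {a b c c' : Fin n} (hab : a ≠ b)
    (h : cflip (cflip u a) c = cflip (cflip u b) c') (hne : cflip (cflip u a) c ≠ u) : c = b := by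
  by_contra hcb
  by_cases hca : c = a
  · subst hca
    exact hne (cflip_cflip u c)
  · have h1 := congrFun h a
    have h2 := congrFun h b
    have h3 := congrFun h c
    simp only [cflip_apply] at h1 h2 h3
    by_cases hac' : a = c'
    · subst hac'
      simp only [hca, hab, hcb, if_true, if_false, Ne.symm hab, Ne.symm hca] at h1 h2 h3
      cases hx : u c <;> simp_all
    · simp only [hca, hab, hcb, if_true, if_false, Ne.symm hab, Ne.symm hca, hac'] at h1 h2 h3
      cases hx : u a <;> simp_all

/-- Every embedding of `G_d` meets every residue class of weights mod 3. -/
lemma class_free (d : ℕ) (hd : 2 ≤ d) (n c : ℕ) (hc : c < 3) :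
    IsFree (Gconf d) ((Finset.univ.filter fun x : Fin n → Bool => cubeWeight x % 3 ≠ c :
      Finset (Fin n → Bool)) : Set (Fin n → Bool)) := by
  intro i hi hsub
  obtain ⟨hinj, hedge⟩ := hi
  set k0 : Fin d := ⟨0, by omega⟩ with hk0
  set k1 : Fin d := ⟨1, by omega⟩ with hk1
  have hk : k0 ≠ k1 := by simp [hk0, hk1]
  set z : Fin d → Bool := fun _ => false with hz
  set y0 : Fin d → Bool := fun k => decide (k = k0) with hy0
  set y1 : Fin d → Bool := fun k => decide (k = k1) with hy1
  set y2 : Fin d → Bool := fun k => decide (k = k0 ∨ k = k1) with hy2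
  have mz : z ∈ Gconf d := by left; simp [cubeWeight, hz]
  have m0 : y0 ∈ Gconf d := by right; left; unfold cubeWeight; rw [Finset.card_eq_one]; exact ⟨k0, by ext k; simp [hy0]⟩
  have m1 : y1 ∈ Gconf d := by right; left; unfold cubeWeight; rw [Finset.card_eq_one]; exact ⟨k1, by ext k; simp [hy1]⟩
  have s2 : (Finset.univ.filter fun k => y2 k = true) = {k0, k1} := by
    ext k; simp [hy2]
  have m2 : y2 ∈ Gconf d := by
    right; right
    refine ⟨?_, k0, k1, ?_, ?_⟩
    · unfold cubeWeight; rw [s2]; exact Finset.card_pair hk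
    · simp [hk0, hk1]
    · exact s2
  have d0 : hammingDist z y0 = 1 := by
    unfold hammingDist
    rw [Finset.card_eq_one]; refine ⟨k0, ?_⟩; ext k; simp [hz, hy0]
  have d1 : hammingDist z y1 = 1 := by
    unfold hammingDist
    rw [Finset.card_eq_one]; refine ⟨k1, ?_⟩; ext k; simp [hz, hy1]
  have d02 : hammingDist y0 y2 = 1 := by
    unfold hammingDist
    rw [Finset.card_eq_one]; refine ⟨k1, ?_⟩; ext k
    by_cases h0 : k = k0
    · simp [h0, hy0, hy2, hk]
    · simp [h0, hy0, hy2]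
  have d12 : hammingDist y1 y2 = 1 := by
    unfold hammingDist
    rw [Finset.card_eq_one]; refine ⟨k0, ?_⟩; ext k
    by_cases h0 : k = k1
    · simp [h0, hy1, hy2, hk.symm]
    · simp [h0, hy1, hy2]
  have n01 : y0 ≠ y1 := by
    intro h
    have := congrFun h k0
    simp [hy0, hy1, hk] at this
  have n2z : y2 ≠ z := by
    intro h
    have := congrFun h k0
    simp [hy2, hz] at this
  obtain ⟨a, ha⟩ := exists_cflip_of_dist (hedge _ _ d0)
  obtain ⟨b, hb⟩ := exists_cflip_of_dist (hedge _ _ d1)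
  obtain ⟨e, he⟩ := exists_cflip_of_dist (hedge _ _ d02)
  obtain ⟨e', he'⟩ := exists_cflip_of_dist (hedge _ _ d12)
  have hab : a ≠ b := by
    rintro rfl
    exact n01 (hinj (ha.trans hb.symm))
  rw [ha] at he
  rw [hb] at he'
  have heb : e = b := square_struct hab (he.symm.trans he')
    (by rw [← he]; exact fun h => n2z (hinj h))
  subst heb
  have wz := hsub ⟨z, mz, rfl⟩
  have w0 := hsub ⟨y0, m0, rfl⟩
  have w1 := hsub ⟨y1, m1, rfl⟩
  have w2 := hsub ⟨y2, m2, rfl⟩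
  simp only [Finset.coe_filter, Finset.mem_univ, true_and, Set.mem_ofPred_eq] at wz w0 w1 w2
  rw [ha] at w0
  rw [hb] at w1
  rw [he] at w2
  have e0 := weight_cflip (i z) a
  have e1 := weight_cflip (i z) e
  have e2 := weight_cflip (cflip (i z) a) e
  rw [cflip_apply, if_neg (Ne.symm hab)] at e2
  split_ifs at e0 e1 e2 <;> omega

lemma exc_bdd {d : ℕ} (n : ℕ) (F : Set (Fin d → Bool)) :
    BddAbove {k : ℕ | ∃ S : Finset (Fin n → Bool), IsFree F (S : Set (Fin n → Bool)) ∧ S.card = k} := by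
  refine ⟨2 ^ n, ?_⟩
  rintro k ⟨S, -, rfl⟩
  have := Finset.card_le_univ S
  simpa using this

lemma exc_lower (d : ℕ) (hd : 2 ≤ d) (n : ℕ) : 2 * 2 ^ n ≤ 3 * exc n (Gconf d) := by
  have key : ∀ c < 3, (Finset.univ.filter fun x : Fin n → Bool => cubeWeight x % 3 ≠ c).card
      ≤ exc n (Gconf d) := fun c hc => le_csSup (exc_bdd n _) ⟨_, class_free d hd n c hc, rfl⟩
  have h0 := key 0 (by norm_num)
  have h1 := key 1 (by norm_num)
  have h2 := key 2 (by norm_num)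
  have hs : (Finset.univ.filter fun x : Fin n → Bool => cubeWeight x % 3 ≠ 0).card
     + (Finset.univ.filter fun x : Fin n → Bool => cubeWeight x % 3 ≠ 1).card
     + (Finset.univ.filter fun x : Fin n → Bool => cubeWeight x % 3 ≠ 2).card = 2 * 2 ^ n := by
    have hcard : Fintype.card (Fin n → Bool) = 2 ^ n := by simp
    rw [← hcard, ← Finset.card_univ, Finset.card_filter, Finset.card_filter, Finset.card_filter,
      ← Finset.sum_add_distrib, ← Finset.sum_add_distrib, Finset.card_eq_sum_ones, Finset.mul_sum]
    apply Finset.sum_congr rfl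
    intro x _
    have : cubeWeight x % 3 < 3 := Nat.mod_lt _ (by norm_num)
    interval_cases cubeWeight x % 3 <;> simp
  omega

/-- Kővári–Sós–Turán, weak form. -/
lemma kst (t : ℕ) (ht : 1 ≤ t) (ε : ℝ) (hε : 0 < ε) : ∃ N : ℕ, ∀ n ≥ N,
    ∀ R : Fin n → Fin n → Prop, ∀ _ : ∀ a b, Decidable (R a b),
    ε * n ^ 2 ≤ ∑ v : Fin n, ((Finset.univ.filter fun a => R a v).card : ℝ) →
    ∃ A B : Finset (Fin n), A.card = t ∧ B.card = t ∧ ∀ a ∈ A, ∀ b ∈ B, R a b := by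
  obtain ⟨N1, hN1⟩ := exists_nat_gt (t / (ε / 2) ^ t : ℝ)
  obtain ⟨N2, hN2⟩ := exists_nat_gt (2 * t / ε : ℝ)
  refine ⟨max (max N1 N2) 1, fun n hn R _ hR => ?_⟩
  have hn1 : (N1 : ℝ) ≤ n := by exact_mod_cast (le_trans (le_max_left _ _) (le_trans (le_max_left _ _) hn))
  have hn2 : (N2 : ℝ) ≤ n := by exact_mod_cast (le_trans (le_max_right _ _) (le_trans (le_max_left _ _) hn))
  have hn0 : (0 : ℝ) < n := by exact_mod_cast (le_trans (le_max_right _ _) hn)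
  by_contra hcon
  push Not at hcon
  set D : Fin n → Finset (Fin n) := fun v => Finset.univ.filter fun a => R a v with hD
  -- upper bound for the number of stars
  have h1 : ∑ v : Fin n, (D v).card.choose t ≤ t * n.choose t := by
    have e1 : ∑ v : Fin n, (D v).card.choose t =
        ∑ A ∈ Finset.powersetCard t (Finset.univ : Finset (Fin n)),
          (Finset.univ.filter fun v => A ⊆ D v).card := by
      refine Eq.trans ?_ (Finset.sum_card_bipartiteAbove_eq_sum_card_bipartiteBelow (fun (v : Fin n) (A : Finset (Fin n)) => A ⊆ D v))
      apply Finset.sum_congr rfl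
      intro v _
      rw [← Finset.card_powersetCard]
      congr 1
      ext A
      simp [Finset.bipartiteAbove, Finset.mem_powersetCard, and_comm]
    rw [e1]
    calc _ ≤ ∑ A ∈ Finset.powersetCard t (Finset.univ : Finset (Fin n)), t := by
          apply Finset.sum_le_sum
          intro A hA
          rw [Finset.mem_powersetCard] at hA
          by_contra hlt
          push Not at hlt
          obtain ⟨B, hB, hBt⟩ := Finset.exists_subset_card_eq hlt.le
          obtain ⟨a, ha, b, hb, hab⟩ := hcon A B hA.2 hBt
          have := hB hb
          rw [Finset.mem_filter] at this
          have := this.2 ha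
          simp [hD] at this
          exact hab this
      _ = t * n.choose t := by simp [mul_comm]
  have h2 : ∑ v : Fin n, ((D v).card + 1 - t) ^ t ≤ t * n ^ t := by
    calc _ ≤ ∑ v : Fin n, t.factorial * (D v).card.choose t := by
          apply Finset.sum_le_sum
          intro v _
          rw [← Nat.descFactorial_eq_factorial_mul_choose]
          exact Nat.pow_sub_le_descFactorial _ _
      _ = t.factorial * ∑ v : Fin n, (D v).card.choose t := by rw [Finset.mul_sum]
      _ ≤ t.factorial * (t * n.choose t) := Nat.mul_le_mul_left _ h1
      _ = t * n.descFactorial t := by rw [Nat.descFactorial_eq_factorial_mul_choose]; ring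
      _ ≤ t * n ^ t := Nat.mul_le_mul_left _ (Nat.descFactorial_le_pow _ _)
  have h2' : ∑ v : Fin n, (((D v).card + 1 - t : ℕ) : ℝ) ^ t ≤ t * n ^ t := by exact_mod_cast h2
  have h3 : ε / 2 * n ^ 2 ≤ ∑ v : Fin n, (((D v).card + 1 - t : ℕ) : ℝ) := by
    have : ∑ v : Fin n, (((D v).card : ℝ) - t) ≤ ∑ v : Fin n, (((D v).card + 1 - t : ℕ) : ℝ) := by
      apply Finset.sum_le_sum
      intro v _
      have : (D v).card ≤ ((D v).card + 1 - t) + t := by omega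
      have : ((D v).card : ℝ) ≤ (((D v).card + 1 - t : ℕ) : ℝ) + t := by exact_mod_cast this
      linarith
    rw [Finset.sum_sub_distrib] at this
    simp only [Finset.sum_const, Finset.card_univ, Fintype.card_fin, nsmul_eq_mul] at this
    have h4 : 2 * t / ε < n := lt_of_lt_of_le hN2 hn2
    rw [div_lt_iff₀ hε] at h4
    nlinarith
  obtain ⟨s, rfl⟩ : ∃ s, t = s + 1 := ⟨t - 1, by omega⟩
  have h5 := pow_sum_le_card_mul_sum_pow (s := (Finset.univ : Finset (Fin n)))
    (f := fun v => (((D v).card + 1 - (s + 1) : ℕ) : ℝ)) (fun _ _ => Nat.cast_nonneg _) s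
  simp only [Finset.card_univ, Fintype.card_fin] at h5
  have h6 : (ε / 2 * n ^ 2) ^ (s + 1) ≤ (n : ℝ) ^ s * ((s + 1 : ℕ) * n ^ (s + 1)) :=
    (pow_le_pow_left₀ (by positivity) h3 _).trans (h5.trans (by gcongr))
  have h7 : ((s + 1 : ℕ) : ℝ) < n * (ε / 2) ^ (s + 1) := by
    have h4 := lt_of_lt_of_le hN1 hn1
    rwa [div_lt_iff₀ (by positivity)] at h4
  have h8 : (ε / 2 * n ^ 2) ^ (s + 1) = (n * (ε / 2) ^ (s + 1)) * ((n : ℝ) ^ s * n ^ (s + 1)) := by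
    rw [mul_pow]; ring
  rw [h8] at h6
  have h9 : (0 : ℝ) < (n : ℝ) ^ s * n ^ (s + 1) := by positivity
  have := mul_lt_mul_of_pos_right h7 h9
  linarith

/-- A complete bipartite local structure yields an embedding of `G_d`. -/
lemma not_free_of_bip {d n : ℕ} (hd : 2 ≤ d) (S : Finset (Fin n → Bool)) (x : Fin n → Bool)
    (hx : x ∈ S) (A B : Finset (Fin n)) (hA : A.card = d) (hB : B.card = d)
    (h : ∀ a ∈ A, ∀ b ∈ B, a ≠ b ∧ cflip x a ∈ S ∧ cflip x b ∈ S ∧ cflip (cflip x a) b ∈ S) :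
    ¬ IsFree (Gconf d) (S : Set (Fin n → Bool)) := by
  intro hfree
  obtain ⟨a0, ha0⟩ := Finset.card_pos.1 (by omega : 0 < A.card)
  obtain ⟨b0, hb0⟩ := Finset.card_pos.1 (by omega : 0 < B.card)
  set g : Fin d → Fin n := fun k =>
    if (k : ℕ) % 2 = 0 then A.orderEmbOfFin hA k else B.orderEmbOfFin hB k with hg
  have gA : ∀ k : Fin d, (k : ℕ) % 2 = 0 → g k ∈ A := by
    intro k hk
    simp only [hg, hk, if_true]
    exact Finset.orderEmbOfFin_mem _ _ _
  have gB : ∀ k : Fin d, ¬ (k : ℕ) % 2 = 0 → g k ∈ B := by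
    intro k hk
    simp only [hg, hk, if_false]
    exact Finset.orderEmbOfFin_mem _ _ _
  have ginj : Function.Injective g := by
    intro k l hkl
    by_cases hk : (k : ℕ) % 2 = 0 <;> by_cases hl : (l : ℕ) % 2 = 0
    · simpa [hg, hk, hl] using hkl
    · exact absurd hkl (h _ (gA k hk) _ (gB l hl)).1
    · exact absurd hkl.symm (h _ (gA l hl) _ (gB k hk)).1
    · simpa [hg, hk, hl] using hkl
  set i : (Fin d → Bool) → (Fin n → Bool) := fun y m =>
    xor (x m) (decide (∃ k, g k = m ∧ y k = true)) with hi
  have hdist : ∀ u v, hammingDist (i u) (i v) = hammingDist u v := by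
    intro u v
    unfold hammingDist
    rw [← Finset.card_image_of_injective _ ginj]
    congr 1
    ext m
    simp only [Finset.mem_filter, Finset.mem_univ, true_and, Finset.mem_image]
    by_cases hm : ∃ k, g k = m
    · obtain ⟨k, rfl⟩ := hm
      simp [hi, ginj.eq_iff]
    · have hm' : ∀ k, g k ≠ m := fun k hk => hm ⟨k, hk⟩
      simp [hi, hm']
  refine hfree i ⟨?_, ?_⟩ ?_
  · intro u v huv
    rw [← hammingDist_eq_zero, ← hdist, huv, hammingDist_self]
  · intro u v huv
    rw [hdist, huv]
  · have h1 : ∀ k, cflip x (g k) ∈ S := by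
      intro k
      by_cases hk : (k : ℕ) % 2 = 0
      · exact (h _ (gA k hk) _ hb0).2.1
      · exact (h _ ha0 _ (gB k hk)).2.2.1
    have h2 : ∀ k l : Fin d, (k : ℕ) % 2 ≠ (l : ℕ) % 2 → cflip (cflip x (g k)) (g l) ∈ S := by
      intro k l hkl
      by_cases hk : (k : ℕ) % 2 = 0
      · exact (h _ (gA k hk) _ (gB l (by omega))).2.2.2
      · rw [cflip_comm]
        exact (h _ (gA l (by omega)) _ (gB k hk)).2.2.2
    rintro _ ⟨y, hy, rfl⟩
    rw [Finset.mem_coe]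
    rcases hy with hy | hy | ⟨-, k, l, hkl, hy⟩
    · have hy' : ∀ k, y k = false := by
        simpa [cubeWeight, Finset.filter_eq_empty_iff] using hy
      have : i y = x := by
        funext m; simp [hi, hy']
      rwa [this]
    · obtain ⟨k, hk⟩ := Finset.card_eq_one.1 hy
      have hy' : ∀ j, y j = true ↔ j = k := by
        intro j
        have := Finset.ext_iff.1 hk j
        simpa using this
      have : i y = cflip x (g k) := by
        funext m
        simp only [hi, hy', cflip_apply, exists_eq_right]
        by_cases hm : m = g k
        · simp [hm]
        · simp [hm, Ne.symm hm]
      rw [this]; exact h1 k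
    · have hy' : ∀ j, y j = true ↔ (j = k ∨ j = l) := by
        intro j
        have := Finset.ext_iff.1 hy j
        simpa [cubeSupp] using this
      have hgkl : g k ≠ g l := fun hh => hkl (by rw [ginj hh])
      have : i y = cflip (cflip x (g k)) (g l) := by
        funext m
        simp only [hi, hy', cflip_apply]
        have e : (∃ j, g j = m ∧ (j = k ∨ j = l)) ↔ (m = g k ∨ m = g l) := by
          constructor
          · rintro ⟨j, rfl, rfl | rfl⟩ <;> simp
          · rintro (rfl | rfl)
            · exact ⟨k, rfl, Or.inl rfl⟩
            · exact ⟨l, rfl, Or.inr rfl⟩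
        simp only [e]
        by_cases hm : m = g k
        · subst hm; simp [hgkl]
        · by_cases hm' : m = g l
          · subst hm'; simp [Ne.symm hgkl]
          · simp [hm, hm']
      rw [this]; exact h2 k l hkl

lemma pointwise_aux (E P Q T : Prop) [Decidable E] [Decidable P] [Decidable Q] [Decidable T] :
    (if T then (1 : ℝ) else 0) ≤ 1 - (if P then (1 : ℝ) else 0) * (if Q then (1 : ℝ) else 0) +
      ((if ¬ E ∧ P ∧ Q ∧ T then (1 : ℝ) else 0) + (if E then (1 : ℝ) else 0)) := by
  by_cases hE : E <;> by_cases hP : P <;> by_cases hQ : Q <;> by_cases hT : T <;>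
    simp [hE, hP, hQ, hT]

/-- The counting inequality. -/
lemma count_bound {n : ℕ} (hn : 0 < n) (S : Finset (Fin n → Bool)) (ε : ℝ)
    (h : ∀ x ∈ S, ∑ b : Fin n, ((Finset.univ.filter fun a =>
      a ≠ b ∧ cflip x a ∈ S ∧ cflip x b ∈ S ∧ cflip (cflip x a) b ∈ S).card : ℝ) + n ≤ ε * n ^ 2) :
    (3 / 2 - ε) * S.card ≤ 2 ^ n := by
  set f : (Fin n → Bool) → ℝ := fun x => if x ∈ S then 1 else 0 with hf
  set M : (Fin n → Bool) → ℝ := fun x => ∑ a, f (cflip x a) with hM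
  have fs : ∑ x, f x = S.card := by simp [hf]
  have hcard : ∑ _x : Fin n → Bool, (1 : ℝ) = 2 ^ n := by simp
  have hMsum : ∑ x, M x = n * S.card := by
    simp only [hM]
    rw [Finset.sum_comm]
    have : ∀ a : Fin n, ∑ x, f (cflip x a) = S.card := by
      intro a
      rw [← fs]
      exact (cflipEquiv a).sum_comp f
    simp [this]
  have hM2 : ∑ x, f x * ∑ b, ∑ a, f (cflip (cflip x a) b) = ∑ x, M x ^ 2 := by
    have e1 : ∀ x, f x * ∑ b, ∑ a, f (cflip (cflip x a) b)
        = ∑ a, f x * ∑ b, f (cflip (cflip x a) b) := by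
      intro x
      rw [Finset.sum_comm, Finset.mul_sum]
    have e2 : ∀ x, M x ^ 2 = ∑ a, f (cflip x a) * ∑ b, f (cflip x b) := by
      intro x
      rw [← Finset.sum_mul, sq]
    simp only [e1, e2]
    rw [Finset.sum_comm, Finset.sum_comm (s := (Finset.univ : Finset (Fin n → Bool)))]
    apply Finset.sum_congr rfl
    intro a _
    rw [← (cflipEquiv a).sum_comp]
    apply Finset.sum_congr rfl
    intro x _
    simp only [cflipEquiv, Equiv.coe_fn_mk, cflip_cflip]
  have hloc : ∀ x, f x * ∑ b, ∑ a, f (cflip (cflip x a) b) ≤ f x * (n ^ 2 - M x ^ 2 + ε * n ^ 2) := by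
    intro x
    by_cases hx : x ∈ S
    · have hfx : f x = 1 := by simp [hf, hx]
      rw [hfx, one_mul, one_mul]
      refine le_trans ?_ (add_le_add_right (h x hx) _)
      have e2 : M x ^ 2 = ∑ b, ∑ a, f (cflip x a) * f (cflip x b) := by
        rw [sq]; simp only [hM]; rw [Finset.sum_mul_sum, Finset.sum_comm]
      have e3 : (n : ℝ) ^ 2 = ∑ b : Fin n, ∑ a : Fin n, (1 : ℝ) := by simp [sq]
      have e4 : (n : ℝ) = ∑ b : Fin n, ∑ a : Fin n, (if a = b then (1 : ℝ) else 0) := by simp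
      have e5 : ∑ b : Fin n, ((Finset.univ.filter fun a =>
          a ≠ b ∧ cflip x a ∈ S ∧ cflip x b ∈ S ∧ cflip (cflip x a) b ∈ S).card : ℝ)
          = ∑ b : Fin n, ∑ a : Fin n, (if a ≠ b ∧ cflip x a ∈ S ∧ cflip x b ∈ S ∧
            cflip (cflip x a) b ∈ S then (1 : ℝ) else 0) := by
        apply Finset.sum_congr rfl
        intro b _
        rw [Finset.card_filter]; push_cast; rfl
      rw [e5, e2, e3]
      refine le_trans ?_ (add_le_add_right (add_le_add_right e4.ge _) _)
      rw [← Finset.sum_sub_distrib, ← Finset.sum_add_distrib, ← Finset.sum_add_distrib]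
      apply Finset.sum_le_sum
      intro b _
      rw [← Finset.sum_sub_distrib, ← Finset.sum_add_distrib, ← Finset.sum_add_distrib]
      apply Finset.sum_le_sum
      intro a _
      simp only [hf]
      exact pointwise_aux _ _ _ _
    · simp [hf, hx]
  have htot : ∑ x, M x ^ 2 ≤ ∑ x, f x * (n ^ 2 - M x ^ 2 + ε * n ^ 2) := by
    rw [← hM2]; exact Finset.sum_le_sum fun x _ => hloc x
  have hpt : ∀ x, 2 * n * M x - n ^ 2 * 1 + n ^ 2 / 2 * f x - (1 + ε) * n ^ 2 * f x
      ≤ M x ^ 2 - f x * (n ^ 2 - M x ^ 2 + ε * n ^ 2) := by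
    intro x
    by_cases hx : x ∈ S
    · have hfx : f x = 1 := by simp [hf, hx]
      rw [hfx]
      nlinarith [sq_nonneg (2 * M x - n)]
    · have hfx : f x = 0 := by simp [hf, hx]
      rw [hfx]
      nlinarith [sq_nonneg (M x - n)]
  have hfin := Finset.sum_le_sum fun x (_ : x ∈ (Finset.univ : Finset (Fin n → Bool))) => hpt x
  rw [Finset.sum_sub_distrib, Finset.sum_add_distrib, Finset.sum_sub_distrib, ← Finset.mul_sum,
    ← Finset.mul_sum, ← Finset.mul_sum, ← Finset.mul_sum, Finset.sum_sub_distrib, hcard, hMsum,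
    fs] at hfin
  have hn' : (0 : ℝ) < (n : ℝ) ^ 2 := by positivity
  have : (n : ℝ) ^ 2 * ((3 / 2 - ε) * S.card) ≤ n ^ 2 * 2 ^ n := by nlinarith
  exact le_of_mul_le_mul_left this hn'

lemma exc_upper (d : ℕ) (hd : 2 ≤ d) (ε : ℝ) (hε : 0 < ε) : ∃ N : ℕ, ∀ n ≥ N,
    (exc n (Gconf d) : ℝ) ≤ (2 / 3 + ε) * 2 ^ n := by
  obtain ⟨N1, hN1⟩ := kst d (by omega) (ε / 2) (by positivity)
  obtain ⟨N2, hN2⟩ := exists_nat_gt (2 / ε)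
  refine ⟨max (max N1 N2) 1, fun n hn => ?_⟩
  have hn1 : N1 ≤ n := le_trans (le_max_left _ _) (le_trans (le_max_left _ _) hn)
  have hn2 : (N2 : ℝ) ≤ n := by exact_mod_cast (le_trans (le_max_right _ _) (le_trans (le_max_left _ _) hn))
  have hn0 : 0 < n := le_trans (le_max_right _ _) hn
  have hn0' : (0 : ℝ) < n := by exact_mod_cast hn0
  have hne : {k : ℕ | ∃ S : Finset (Fin n → Bool), IsFree (Gconf d) (S : Set (Fin n → Bool)) ∧
      S.card = k}.Nonempty := ⟨_, _, class_free d hd n 0 (by norm_num), rfl⟩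
  obtain ⟨S, hfree, hS⟩ := Nat.sSup_mem hne (exc_bdd n (Gconf d))
  have hS' : exc n (Gconf d) = S.card := hS.symm
  rw [hS']
  have hcb := count_bound hn0 S ε (by
    intro x hx
    by_contra hlt
    push Not at hlt
    have h4 : 2 / ε < n := lt_of_lt_of_le hN2 hn2
    rw [div_lt_iff₀ hε] at h4
    obtain ⟨A, B, hA, hB, hAB⟩ := hN1 n hn1 (fun a b => a ≠ b ∧ cflip x a ∈ S ∧ cflip x b ∈ S ∧
      cflip (cflip x a) b ∈ S) inferInstance (by nlinarith)
    exact not_free_of_bip hd S x hx A B hA hB hAB hfree)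
  have hcard : (S.card : ℝ) ≤ 2 ^ n := by
    have := Finset.card_le_univ S
    have h2 : S.card ≤ 2 ^ n := by simpa using this
    exact_mod_cast h2
  nlinarith

/-- For every d ≥ 2, the vertex Turán density of G_d is 2/3. -/
theorem lambda_Gd (d : ℕ) (hd : 2 ≤ d) :
    Tendsto (fun n : ℕ => (exc n (Gconf d) : ℝ) / 2 ^ n) atTop (𝓝 (2 / 3)) := by
  rw [Metric.tendsto_atTop]
  intro ε hε
  obtain ⟨N, hN⟩ := exc_upper d hd (ε / 2) (by positivity)
  refine ⟨N, fun n hn => ?_⟩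
  have hp : (0 : ℝ) < 2 ^ n := by positivity
  have hu : (exc n (Gconf d) : ℝ) / 2 ^ n ≤ 2 / 3 + ε / 2 := by
    rw [div_le_iff₀ hp]; exact hN n hn
  have hl : 2 / 3 ≤ (exc n (Gconf d) : ℝ) / 2 ^ n := by
    rw [le_div_iff₀ hp]
    have : (2 : ℝ) * 2 ^ n ≤ 3 * exc n (Gconf d) := by exact_mod_cast exc_lower d hd n
    linarith
  rw [Real.dist_eq, abs_lt]
  constructor <;> linarith
end

section
/- λ({F_2, F_3}) = 1/4; that is, exc(n, {F_2,F_3})/2^n → 1/4 as n → ∞, where exc(n, {F_2,F_3}) is the maximum size of a subset of V_n that is simultaneously F_2-free and F_3-free. -/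
open Finset Filter Topology

/-- F₁ = {(0,0,0),(1,0,0),(0,1,0),(0,0,1)} ⊆ V₃. -/
def F1 : Set (Fin 3 → Bool) :=
  {![false, false, false], ![true, false, false], ![false, true, false], ![false, false, true]}

/-- F₂ = {(0,0,0),(1,1,0),(1,0,1),(0,1,1)} ⊆ V₃. -/
def F2 : Set (Fin 3 → Bool) :=
  {![false, false, false], ![true, true, false], ![true, false, true], ![false, true, true]}

/-- F₃ = {(0,0,0),(1,1,1)} ⊆ V₃. -/
def F3 : Set (Fin 3 → Bool) :=
  {![false, false, false], ![true, true, true]}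

/-- The maximum size of a subset of V_n that is simultaneously F-free and G-free. -/
noncomputable def exc2 {d : ℕ} (n : ℕ) (F G : Set (Fin d → Bool)) : ℕ :=
  sSup {k : ℕ | ∃ S : Finset (Fin n → Bool),
    IsFree F (S : Set (Fin n → Bool)) ∧ IsFree G (S : Set (Fin n → Bool)) ∧ S.card = k}

/-- Flip coordinate `a`. -/
def fl {n : ℕ} (x : Fin n → Bool) (a : Fin n) : Fin n → Bool := Function.update x a (!x a)

lemma fl_same {n : ℕ} (x : Fin n → Bool) (a : Fin n) : fl x a a = !x a := by simp [fl]

lemma fl_ne {n : ℕ} (x : Fin n → Bool) {a k : Fin n} (h : k ≠ a) : fl x a k = x k := by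
  simp [fl, h]

lemma fl_fl {n : ℕ} (x : Fin n → Bool) (a : Fin n) : fl (fl x a) a = x := by
  ext k
  by_cases h : k = a
  · subst h; simp [fl]
  · simp [fl, h]

lemma fl_comm {n : ℕ} (x : Fin n → Bool) (a b : Fin n) : fl (fl x a) b = fl (fl x b) a := by
  by_cases h : a = b
  · subst h; rfl
  · ext k
    by_cases ha : k = a
    · subst ha; simp [fl, h, Ne.symm h]
    · by_cases hb : k = b
      · subst hb; simp [fl, h, Ne.symm h]
      · simp [fl, ha, hb]

/-- The standard embedding attached to a base point and three directions. -/
noncomputable def emb {n : ℕ} (x : Fin n → Bool) (p : Fin 3 → Fin n) (y : Fin 3 → Bool) : Fin n → Bool :=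
  fun k => xor (x k) (Function.extend p y (fun _ => false) k)

lemma emb_dist {n : ℕ} (x : Fin n → Bool) (p : Fin 3 → Fin n) (hp : Function.Injective p)
    (y z : Fin 3 → Bool) : hammingDist (emb x p y) (emb x p z) = hammingDist y z := by
  unfold hammingDist
  rw [← Finset.card_map ⟨p, hp⟩]
  congr 1
  ext k
  simp only [Finset.mem_filter, Finset.mem_univ, true_and, Finset.mem_map,
    Function.Embedding.coeFn_mk]
  by_cases h : ∃ j, p j = k
  · obtain ⟨j, rfl⟩ := h
    simp [emb, hp.extend_apply, hp.eq_iff]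
  · simp only [emb, Function.extend_apply' _ _ _ h]
    simp only [ne_eq, not_true_eq_false, false_iff]
    rintro ⟨j, -, hj⟩
    exact h ⟨j, hj⟩

lemma emb_isCubeEmbedding {n : ℕ} (x : Fin n → Bool) (p : Fin 3 → Fin n)
    (hp : Function.Injective p) : IsCubeEmbedding (emb x p) := by
  refine ⟨fun y z h => ?_, fun y z h => by rw [emb_dist x p hp, h]⟩
  rw [← hammingDist_eq_zero, ← emb_dist x p hp, h, hammingDist_self]

lemma emb_eq {n : ℕ} (x : Fin n → Bool) (p : Fin 3 → Fin n) (hp : Function.Injective p)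
    (y : Fin 3 → Bool) (w : Fin n → Bool) (h1 : ∀ j, w (p j) = xor (x (p j)) (y j))
    (h2 : ∀ k, (∀ j, p j ≠ k) → w k = x k) : emb x p y = w := by
  ext k
  by_cases h : ∃ j, p j = k
  · obtain ⟨j, rfl⟩ := h
    simp [emb, hp.extend_apply, h1]
  · simp only [emb, Function.extend_apply' _ _ _ h]
    rw [h2 k (by simpa using h)]; simp

lemma inj3 {n : ℕ} {a b c : Fin n} (hab : a ≠ b) (hac : a ≠ c) (hbc : b ≠ c) :
    Function.Injective ![a, b, c] := by
  intro i j h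
  fin_cases i <;> fin_cases j <;> simp_all [eq_comm]

lemma free3 {n : ℕ} {S : Set (Fin n → Bool)} (hS : IsFree F3 S) {x : Fin n → Bool}
    {a b c : Fin n} (hab : a ≠ b) (hac : a ≠ c) (hbc : b ≠ c) (hx : x ∈ S)
    (h : fl (fl (fl x a) b) c ∈ S) : False := by
  have hp := inj3 hab hac hbc
  apply hS _ (emb_isCubeEmbedding x _ hp)
  rintro _ ⟨y, hy, rfl⟩
  rcases hy with rfl | rfl
  · rw [emb_eq x _ hp _ x (fun j => by fin_cases j <;> simp) (fun _ _ => rfl)]; exact hx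
  · rw [emb_eq x _ hp _ (fl (fl (fl x a) b) c)
      (fun j => by fin_cases j <;> simp [fl, hab, hac, hbc, hab.symm, hac.symm, hbc.symm])
      (fun k hk => by
        have h0 := (hk 0).symm; have h1 := (hk 1).symm; have h2 := (hk 2).symm
        simp at h0 h1 h2
        simp [fl, h0, h1, h2])]
    exact h

lemma free2 {n : ℕ} {S : Set (Fin n → Bool)} (hS : IsFree F2 S) {x : Fin n → Bool}
    {a b c : Fin n} (hab : a ≠ b) (hac : a ≠ c) (hbc : b ≠ c) (hx : x ∈ S)
    (h1 : fl (fl x a) b ∈ S) (h2 : fl (fl x a) c ∈ S) (h3 : fl (fl x b) c ∈ S) : False := by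
  have hp := inj3 hab hac hbc
  apply hS _ (emb_isCubeEmbedding x _ hp)
  rintro _ ⟨y, hy, rfl⟩
  rcases hy with rfl | rfl | rfl | rfl
  · rw [emb_eq x _ hp _ x (fun j => by fin_cases j <;> simp) (fun _ _ => rfl)]; exact hx
  · rw [emb_eq x _ hp _ (fl (fl x a) b)
      (fun j => by fin_cases j <;> simp [fl, hab, hac, hbc, hab.symm, hac.symm, hbc.symm])
      (fun k hk => by
        have h0 := (hk 0).symm; have h1 := (hk 1).symm; have h2 := (hk 2).symm
        simp at h0 h1 h2
        simp [fl, h0, h1])]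
    exact h1
  · rw [emb_eq x _ hp _ (fl (fl x a) c)
      (fun j => by fin_cases j <;> simp [fl, hab, hac, hbc, hab.symm, hac.symm, hbc.symm])
      (fun k hk => by
        have h0 := (hk 0).symm; have h1 := (hk 1).symm; have h2 := (hk 2).symm
        simp at h0 h1 h2
        simp [fl, h0, h2])]
    exact h2
  · rw [emb_eq x _ hp _ (fl (fl x b) c)
      (fun j => by fin_cases j <;> simp [fl, hab, hac, hbc, hab.symm, hac.symm, hbc.symm])
      (fun k hk => by
        have h0 := (hk 0).symm; have h1 := (hk 1).symm; have h2 := (hk 2).symm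
        simp at h0 h1 h2
        simp [fl, h1, h2])]
    exact h3

/-- Flipping as a permutation. -/
def flEquiv {n : ℕ} (a : Fin n) : (Fin n → Bool) ≃ (Fin n → Bool) where
  toFun x := fl x a
  invFun x := fl x a
  left_inv x := fl_fl x a
  right_inv x := fl_fl x a

/-- Number of neighbours in `S`. -/
def nb {n : ℕ} (S : Finset (Fin n → Bool)) (v : Fin n → Bool) : ℕ :=
  ∑ a : Fin n, if fl v a ∈ S then 1 else 0

lemma sum_nb {n : ℕ} (S : Finset (Fin n → Bool)) : ∑ v, nb S v = n * S.card := by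
  unfold nb
  rw [Finset.sum_comm]
  have : ∀ a : Fin n, (∑ v : Fin n → Bool, if fl v a ∈ S then 1 else 0) = S.card := by
    intro a
    rw [← Finset.card_filter, ← Finset.card_map (flEquiv a).toEmbedding]
    congr 1
    ext x
    simp only [Finset.mem_map, Finset.mem_filter, Finset.mem_univ, true_and, flEquiv,
      Equiv.coe_toEmbedding, Equiv.coe_fn_mk]
    constructor
    · rintro ⟨v, hv, rfl⟩
      exact hv
    · intro hx
      exact ⟨fl x a, by rwa [fl_fl], fl_fl x a⟩
  simp [this]

lemma sum_nb_sq {n : ℕ} (S : Finset (Fin n → Bool)) :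
    ∑ v, nb S v ^ 2 =
      ∑ x ∈ S, ∑ a : Fin n, ∑ b : Fin n, if fl (fl x a) b ∈ S then 1 else 0 := by
  have h1 : ∀ v, nb S v ^ 2 = ∑ a : Fin n, ∑ b : Fin n,
      (if fl v a ∈ S then 1 else 0) * (if fl v b ∈ S then 1 else 0) := by
    intro v
    rw [sq, nb, Finset.sum_mul_sum]
  simp_rw [h1]
  rw [Finset.sum_comm, Finset.sum_comm (s := S)]
  refine Finset.sum_congr rfl fun a _ => ?_
  rw [← (flEquiv a).sum_comp]
  simp only [flEquiv, Equiv.coe_fn_mk, fl_fl]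
  rw [← Finset.sum_filter_add_sum_filter_not _ (· ∈ S)]
  rw [Finset.sum_eq_zero (s := Finset.univ.filter fun x => ¬ x ∈ S), add_zero]
  · apply Finset.sum_congr (by ext; simp)
    intro x hx
    simp only [hx, if_true, one_mul]
    congr!
  · intro x hx
    simp at hx
    simp [hx]

open Classical in
lemma local_bound {n : ℕ} (S : Finset (Fin n → Bool))
    (hS : IsFree F2 (S : Set (Fin n → Bool))) (x : Fin n → Bool) (hx : x ∈ S) :
    2 * (∑ a : Fin n, ∑ b : Fin n, if fl (fl x a) b ∈ S then 1 else 0) ≤ 2 * n + n ^ 2 := by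
  let G : SimpleGraph (Fin n) :=
    { Adj := fun a b => a ≠ b ∧ fl (fl x a) b ∈ S
      symm := ⟨fun a b h => ⟨h.1.symm, by rw [fl_comm]; exact h.2⟩⟩
      loopless := ⟨fun a h => h.1 rfl⟩ }
  have hG : G.CliqueFree (2 + 1) := by
    intro s hs
    rw [SimpleGraph.is3Clique_iff] at hs
    obtain ⟨a, b, c, hab, hac, hbc, -⟩ := hs
    exact free2 hS hab.1 hac.1 hbc.1 hx hab.2 hac.2 hbc.2
  have h1 : ∀ a : Fin n, (∑ b : Fin n, if fl (fl x a) b ∈ S then 1 else 0) ≤ 1 + G.degree a := by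
    intro a
    rw [← Finset.card_filter]
    have : (Finset.univ.filter fun b => fl (fl x a) b ∈ S) ⊆ insert a (G.neighborFinset a) := by
      intro b hb
      simp only [Finset.mem_filter, Finset.mem_univ, true_and] at hb
      simp only [Finset.mem_insert, SimpleGraph.mem_neighborFinset]
      by_cases h : b = a
      · exact Or.inl h
      · exact Or.inr ⟨Ne.symm h, hb⟩
    refine (Finset.card_le_card this).trans ((Finset.card_insert_le _ _).trans ?_)
    rw [SimpleGraph.card_neighborFinset_eq_degree, add_comm]
  have h2 := hG.card_edgeFinset_le
  have h3 : (∑ a : Fin n, ∑ b : Fin n, if fl (fl x a) b ∈ S then 1 else 0)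
      ≤ n + 2 * G.edgeFinset.card := by
    refine (Finset.sum_le_sum fun a _ => h1 a).trans ?_
    rw [Finset.sum_add_distrib, G.sum_degrees_eq_twice_card_edges]
    simp
  have h4 : 4 * G.edgeFinset.card ≤ n ^ 2 := by
    simp only [Fintype.card_fin] at h2
    have h5 : (n % 2).choose 2 = 0 := Nat.choose_eq_zero_of_lt (Nat.mod_lt _ (by norm_num))
    rw [h5] at h2
    omega
  omega

lemma exists_ne_nb {n : ℕ} (S : Finset (Fin n → Bool)) (v : Fin n → Bool) (h : 3 ≤ nb S v)
    (a b : Fin n) : ∃ c, c ≠ a ∧ c ≠ b ∧ fl v c ∈ S := by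
  by_contra! hc
  rw [nb, ← Finset.card_filter] at h
  have : (Finset.univ.filter fun c => fl v c ∈ S) ⊆ {a, b} := by
    intro c hcS
    simp only [Finset.mem_filter, Finset.mem_univ, true_and] at hcS
    simp only [Finset.mem_insert, Finset.mem_singleton]
    by_contra! hh
    exact hc c hh.1 hh.2 hcS
  have := (Finset.card_le_card this).trans Finset.card_le_two
  omega

lemma card_W {n : ℕ} (hn : 0 < n) (S : Finset (Fin n → Bool))
    (hS : IsFree F3 (S : Set (Fin n → Bool))) :
    2 * (Finset.univ.filter fun v => 3 ≤ nb S v).card ≤ 2 ^ n := by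
  set W := Finset.univ.filter fun v => 3 ≤ nb S v with hW
  let a : Fin n := ⟨0, hn⟩
  have hd : Disjoint W (W.map (flEquiv a).toEmbedding) := by
    rw [Finset.disjoint_left]
    intro v hv hv'
    rw [Finset.mem_map] at hv'
    obtain ⟨u, hu, rfl⟩ := hv'
    simp only [hW, Finset.mem_filter, Finset.mem_univ, true_and, flEquiv, Equiv.coe_toEmbedding,
      Equiv.coe_fn_mk] at hu hv
    obtain ⟨b, hb, -, hbS⟩ := exists_ne_nb S u hu a a
    obtain ⟨c, hca, hcb, hcS⟩ := exists_ne_nb S _ hv a b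
    refine free3 hS hb hcb.symm hca.symm (x := fl u b) (by simpa using hbS) ?_
    rw [fl_fl]; simpa using hcS
  have := Finset.card_le_univ (W ∪ W.map (flEquiv a).toEmbedding)
  rw [Finset.card_union_of_disjoint hd, Finset.card_map] at this
  simp at this
  omega

lemma upper {n : ℕ} (hn : 0 < n) (S : Finset (Fin n → Bool))
    (hS2 : IsFree F2 (S : Set (Fin n → Bool))) (hS3 : IsFree F3 (S : Set (Fin n → Bool))) :
    (S.card : ℝ) / 2 ^ n ≤ 1 / 4 + 9 / 2 / n := by
  set W := Finset.univ.filter fun v => 3 ≤ nb S v with hW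
  have hWc : 2 * (W.card : ℝ) ≤ 2 ^ n := by exact_mod_cast card_W hn S hS3
  have h1 : n * S.card ≤ ∑ v ∈ W, nb S v + 2 * 2 ^ n := by
    rw [← sum_nb, ← Finset.sum_filter_add_sum_filter_not _ (fun v => 3 ≤ nb S v)]
    gcongr
    refine (Finset.sum_le_card_nsmul _ _ 2 ?_).trans ?_
    · intro v hv
      simp at hv
      omega
    · have := Finset.card_le_univ (Finset.univ.filter fun v => ¬ 3 ≤ nb S v)
      simp at this ⊢
      omega
  have h2 : 2 * ∑ v, nb S v ^ 2 ≤ S.card * (2 * n + n ^ 2) := by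
    rw [sum_nb_sq, Finset.mul_sum]
    exact Finset.sum_le_card_nsmul _ _ _ fun x hx => local_bound S hS2 x hx
  have h3 : ∑ v ∈ W, nb S v ^ 2 ≤ ∑ v, nb S v ^ 2 :=
    Finset.sum_le_sum_of_subset (Finset.subset_univ _)
  have h4 : (∑ v ∈ W, (nb S v : ℝ)) ^ 2 ≤ W.card * ∑ v ∈ W, (nb S v : ℝ) ^ 2 :=
    sq_sum_le_card_mul_sum_sq
  have h1' : (n : ℝ) * S.card ≤ ∑ v ∈ W, (nb S v : ℝ) + 2 * 2 ^ n := by exact_mod_cast h1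
  have h2' : 2 * ∑ v ∈ W, (nb S v : ℝ) ^ 2 ≤ S.card * (2 * n + n ^ 2) := by
    exact_mod_cast (Nat.mul_le_mul_left 2 h3).trans h2
  have hs : (0 : ℝ) ≤ S.card := by positivity
  have hn' : (0 : ℝ) < n := by exact_mod_cast hn
  have hN : (0 : ℝ) < 2 ^ n := by positivity
  generalize (∑ v ∈ W, (nb S v : ℝ)) = D at *
  have hQ : 0 ≤ ∑ v ∈ W, (nb S v : ℝ) ^ 2 := by positivity
  generalize (∑ v ∈ W, (nb S v : ℝ) ^ 2) = Q at *
  generalize (W.card : ℝ) = w at *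
  generalize (S.card : ℝ) = s at *
  generalize (2 ^ n : ℝ) = N at *
  generalize (n : ℝ) = m at *
  have key : m * s ≤ N * (9 / 2 + m / 4) := by
    rcases le_or_gt (m * s) (2 * N) with h | h
    · nlinarith [mul_pos hN hn']
    · have hms : 0 < m * s := by linarith
      have a1 : (m * s - 2 * N) ^ 2 ≤ D ^ 2 := by
        apply pow_le_pow_left₀ <;> linarith
      have a2 : 4 * (w * Q) ≤ N * (s * (2 * m + m ^ 2)) := by
        nlinarith [mul_le_mul_of_nonneg_right hWc hQ, mul_le_mul_of_nonneg_left h2' hN.le]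
      by_contra! hc
      nlinarith [mul_lt_mul_of_pos_left hc hms, sq_nonneg N]
  rw [div_le_iff₀ hN, ← sub_nonneg]
  have : (1 / 4 + 9 / 2 / m) * N - s = (N * (9 / 2 + m / 4) - m * s) / m := by
    field_simp
    ring
  rw [this]
  apply div_nonneg _ hn'.le
  linarith

/-! Lower bound -/

lemma exists_fl {n : ℕ} {x y : Fin n → Bool} (h : hammingDist x y = 1) : ∃ a, y = fl x a := by
  unfold hammingDist at h
  rw [Finset.card_eq_one] at h
  obtain ⟨a, ha⟩ := h
  refine ⟨a, ?_⟩
  ext k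
  have hk : x k ≠ y k ↔ k = a := by
    have := congrArg (k ∈ ·) ha
    simpa using this
  by_cases h : k = a
  · subst h
    rw [fl_same]
    have := hk.2 rfl
    revert this
    cases x k <;> cases y k <;> simp
  · rw [fl_ne _ h]
    by_contra hh
    exact h (hk.1 (fun e => hh (by rw [e])))

lemma weight_fl {n : ℕ} (x : Fin n → Bool) (a : Fin n) :
    (x a = false ∧ cubeWeight (fl x a) = cubeWeight x + 1) ∨
    (x a = true ∧ cubeWeight (fl x a) + 1 = cubeWeight x) := by
  have key : ∀ z : Fin n → Bool, z a = false → cubeWeight (fl z a) = cubeWeight z + 1 := by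
    intro z hz
    unfold cubeWeight
    have : (Finset.univ.filter fun i => fl z a i = true)
        = insert a (Finset.univ.filter fun i => z i = true) := by
      ext k
      by_cases h : k = a
      · subst h; simp [fl_same, hz]
      · simp [fl_ne _ h, h]
    rw [this, Finset.card_insert_of_notMem (by simp [hz])]
  cases hx : x a
  · exact Or.inl ⟨rfl, key x hx⟩
  · right
    refine ⟨rfl, ?_⟩
    have := key (fl x a) (by rw [fl_same, hx]; rfl)
    rw [fl_fl] at this
    exact this.symm

lemma common_nb {n : ℕ} {x y : Fin n → Bool} {a b : Fin n} (hab : a ≠ b) (hy : y ≠ x)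
    (h1 : hammingDist (fl x a) y = 1) (h2 : hammingDist (fl x b) y = 1) :
    y = fl (fl x a) b := by
  obtain ⟨c, hc⟩ := exists_fl h1
  obtain ⟨d, hd⟩ := exists_fl h2
  by_cases hcb : c = b
  · rw [hc, hcb]
  · exfalso
    have e1 : y b = x b := by rw [hc, fl_ne _ (Ne.symm hcb), fl_ne _ hab.symm]
    by_cases hdb : d = b
    · apply hy; rw [hd, hdb, fl_fl]
    · have e2 : y b = !x b := by rw [hd, fl_ne _ (Ne.symm hdb), fl_same]
      rw [e1] at e2
      revert e2; cases x b <;> simp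

lemma two_step {n : ℕ} {x : Fin n → Bool} {a b : Fin n} {r : ℕ} (hab : a ≠ b)
    (hx : cubeWeight x % 4 = r) (hy : cubeWeight (fl (fl x a) b) % 4 = r) : x a ≠ x b := by
  have h1 := weight_fl x a
  have h2 := weight_fl (fl x a) b
  rw [fl_ne _ hab.symm] at h2
  intro h
  rw [← h] at h2
  rcases h1 with ⟨e1, h1⟩ | ⟨e1, h1⟩ <;> rcases h2 with ⟨e2, h2⟩ | ⟨e2, h2⟩ <;>
    first | omega | (rw [e1] at e2; cases e2)

lemma layer_F3 {n : ℕ} (r : ℕ) : IsFree F3 {x : Fin n → Bool | cubeWeight x % 4 = r} := by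
  intro i hi hsub
  have m0 := hsub ⟨![false, false, false], by simp [F3], rfl⟩
  have m1 := hsub ⟨![true, true, true], by simp [F3], rfl⟩
  simp only [Set.mem_ofPred_eq] at m0 m1
  obtain ⟨a, ha⟩ := exists_fl (hi.2 ![false, false, false] ![true, false, false] (by decide))
  obtain ⟨b, hb⟩ := exists_fl (hi.2 ![true, false, false] ![true, true, false] (by decide))
  obtain ⟨c, hc⟩ := exists_fl (hi.2 ![true, true, false] ![true, true, true] (by decide))
  have h1 := weight_fl (i ![false, false, false]) a
  have h2 := weight_fl (i ![true, false, false]) b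
  have h3 := weight_fl (i ![true, true, false]) c
  rw [← ha] at h1
  rw [← hb] at h2
  rw [← hc] at h3
  omega

lemma layer_F2 {n : ℕ} (r : ℕ) : IsFree F2 {x : Fin n → Bool | cubeWeight x % 4 = r} := by
  intro i hi hsub
  have m0 := hsub ⟨![false, false, false], by simp [F2], rfl⟩
  have m1 := hsub ⟨![true, true, false], by simp [F2], rfl⟩
  have m2 := hsub ⟨![true, false, true], by simp [F2], rfl⟩
  have m3 := hsub ⟨![false, true, true], by simp [F2], rfl⟩
  simp only [Set.mem_ofPred_eq] at m0 m1 m2 m3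
  obtain ⟨a, ha⟩ := exists_fl (hi.2 ![false, false, false] ![true, false, false] (by decide))
  obtain ⟨b, hb⟩ := exists_fl (hi.2 ![false, false, false] ![false, true, false] (by decide))
  obtain ⟨c, hc⟩ := exists_fl (hi.2 ![false, false, false] ![false, false, true] (by decide))
  have hab : a ≠ b := by
    rintro rfl
    exact absurd (hi.1 (ha.trans hb.symm)) (by decide)
  have hac : a ≠ c := by
    rintro rfl
    exact absurd (hi.1 (ha.trans hc.symm)) (by decide)
  have hbc : b ≠ c := by
    rintro rfl
    exact absurd (hi.1 (hb.trans hc.symm)) (by decide)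
  have e1 := common_nb hab (hi.1.ne (by decide : ![true, true, false] ≠ ![false, false, false]))
    (ha ▸ hi.2 ![true, false, false] _ (by decide)) (hb ▸ hi.2 ![false, true, false] _ (by decide))
  have e2 := common_nb hac (hi.1.ne (by decide : ![true, false, true] ≠ ![false, false, false]))
    (ha ▸ hi.2 ![true, false, false] _ (by decide)) (hc ▸ hi.2 ![false, false, true] _ (by decide))
  have e3 := common_nb hbc (hi.1.ne (by decide : ![false, true, true] ≠ ![false, false, false]))
    (hb ▸ hi.2 ![false, true, false] _ (by decide)) (hc ▸ hi.2 ![false, false, true] _ (by decide))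
  rw [e1] at m1
  rw [e2] at m2
  rw [e3] at m3
  have t1 := two_step hab m0 m1
  have t2 := two_step hac m0 m2
  have t3 := two_step hbc m0 m3
  revert t1 t2 t3
  generalize i ![false, false, false] = x
  cases x a <;> cases x b <;> cases x c <;> simp

lemma exists_layer (n : ℕ) : ∃ r, 2 ^ n ≤ 4 *
    (Finset.univ.filter fun x : Fin n → Bool => cubeWeight x % 4 = r).card := by
  by_contra! h
  have h1 : (Finset.univ : Finset (Fin n → Bool)).card = ∑ r ∈ Finset.range 4,
      (Finset.univ.filter fun x : Fin n → Bool => cubeWeight x % 4 = r).card :=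
    Finset.card_eq_sum_card_fiberwise fun x _ => by
      simpa using Nat.mod_lt (cubeWeight x) (by norm_num : 4 > 0)
  simp [Finset.sum_range_succ] at h1
  have := h 0
  have := h 1
  have := h 2
  have := h 3
  omega

lemma exc2_bdd (n : ℕ) : BddAbove {k : ℕ | ∃ S : Finset (Fin n → Bool),
    IsFree F2 (S : Set (Fin n → Bool)) ∧ IsFree F3 (S : Set (Fin n → Bool)) ∧ S.card = k} := by
  refine ⟨2 ^ n, ?_⟩
  rintro k ⟨S, -, -, rfl⟩
  simpa using Finset.card_le_univ S

lemma exc2_lower (n : ℕ) : 2 ^ n ≤ 4 * exc2 n F2 F3 := by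
  obtain ⟨r, hr⟩ := exists_layer n
  refine hr.trans (Nat.mul_le_mul_left 4 (le_csSup (exc2_bdd n) ⟨_, ?_, ?_, rfl⟩))
  · simpa using layer_F2 r
  · simpa using layer_F3 r

lemma exc2_upper {n : ℕ} (hn : 0 < n) : (exc2 n F2 F3 : ℝ) / 2 ^ n ≤ 1 / 4 + 9 / 2 / n := by
  have hne : {k : ℕ | ∃ S : Finset (Fin n → Bool), IsFree F2 (S : Set (Fin n → Bool)) ∧
      IsFree F3 (S : Set (Fin n → Bool)) ∧ S.card = k}.Nonempty :=
    ⟨_, Finset.univ.filter fun x : Fin n → Bool => cubeWeight x % 4 = 0,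
      by simpa using layer_F2 0, by simpa using layer_F3 0, rfl⟩
  obtain ⟨S, h2, h3, h⟩ := Nat.sSup_mem hne (exc2_bdd n)
  have := upper hn S h2 h3
  rw [h] at this
  exact this

/-- λ({F₂, F₃}) = 1/4. -/
theorem lambda_F2F3 :
    Filter.Tendsto (fun n : ℕ => (exc2 n F2 F3 : ℝ) / 2 ^ n) Filter.atTop (𝓝 (1 / 4)) := by
  have hlim : Filter.Tendsto (fun n : ℕ => (1 / 4 + 9 / 2 / n : ℝ)) Filter.atTop (𝓝 (1 / 4)) := by
    simpa using (tendsto_const_div_atTop_nhds_zero_nat (9 / 2 : ℝ)).const_add (1 / 4 : ℝ)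
  refine tendsto_of_tendsto_of_tendsto_of_le_of_le' tendsto_const_nhds hlim ?_ ?_
  · refine Filter.Eventually.of_forall fun n => ?_
    rw [le_div_iff₀ (by positivity)]
    have : (2 : ℝ) ^ n ≤ 4 * exc2 n F2 F3 := by exact_mod_cast exc2_lower n
    linarith
  · filter_upwards [Filter.eventually_gt_atTop 0] with n hn
    exact exc2_upper hn
end

section
/- For every integer d ≥ 2, λ(𝓕_{d, t_2(d)+t_3(d)}) = 0, where t_2(d) = 0 if ⌈d/3⌉ is odd and t_2(d) = 1 otherwise, and t_3(d) = 3^{d/3} if d ≡ 0 (mod 3), t_3(d) = 4·3^{(d−4)/3} if d ≡ 1 (mod 3), and t_3(d) = 2·3^{(d−2)/3} if d ≡ 2 (mod 3). Equivalently: for every ε > 0 there exists n_0 such that for all n ≥ n_0, every S ⊆ V_n with |S| ≥ ε·2^n contains at least t_2(d)+t_3(d) points of the image of some embedding of Q_d into Q_n. -/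
open Finset Filter Topology

/-- `excT n d t`: the maximum size of a subset of V_n that is 𝓕_{d,t}-free, i.e. F-free for
every F ⊆ V_d with |F| = t. -/
noncomputable def excT (n d t : ℕ) : ℕ :=
  sSup {k : ℕ | ∃ S : Finset (Fin n → Bool),
    (∀ F : Set (Fin d → Bool), F.ncard = t → IsFree F (S : Set (Fin n → Bool))) ∧ S.card = k}

/-- t₂(d) = 0 if ⌈d/3⌉ is odd, and 1 otherwise. -/
def t2 (d : ℕ) : ℕ := if (d + 2) / 3 % 2 = 1 then 0 else 1

/-- t₃(d) = 3^{d/3}, 4·3^{(d−4)/3} or 2·3^{(d−2)/3} according to d mod 3 = 0, 1 or 2. -/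
def t3 (d : ℕ) : ℕ :=
  if d % 3 = 0 then 3 ^ (d / 3)
  else if d % 3 = 1 then 4 * 3 ^ ((d - 4) / 3)
  else 2 * 3 ^ ((d - 2) / 3)

/-- density of a predicate on a finite type -/
noncomputable def pdens {α : Type} (P : α → Prop) : ℝ := (Nat.card {a // P a} : ℝ) / Nat.card α

lemma pdens_equiv {α β : Type} (e : α ≃ β) (P : β → Prop) :
    pdens (fun a => P (e a)) = pdens P := by
  unfold pdens
  rw [Nat.card_congr e, Nat.card_congr (e.subtypeEquiv (p := fun a => P (e a)) (q := P) (fun a => Iff.rfl))]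

lemma pdens_congr {α β : Type} (e : α ≃ β) {P : α → Prop} {Q : β → Prop}
    (h : ∀ a, P a ↔ Q (e a)) : pdens P = pdens Q := by
  rw [← pdens_equiv e Q]
  congr 1
  funext a
  exact propext (h a)

lemma pdens_nonneg {α : Type} (P : α → Prop) : 0 ≤ pdens P := by
  unfold pdens; positivity

lemma pdens_fst {α β : Type} [Finite α] [Finite β] [Nonempty β] (P : α → Prop) :
    pdens (fun x : α × β => P x.1) = pdens P := by
  unfold pdens
  have e : {x : α × β // P x.1} ≃ {a // P a} × β :=
    { toFun := fun x => (⟨x.1.1, x.2⟩, x.1.2)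
      invFun := fun x => ⟨(x.1.1, x.2), x.1.2⟩
      left_inv := fun x => rfl
      right_inv := fun x => rfl }
  rw [Nat.card_congr e, Nat.card_prod, Nat.card_prod]
  have : (Nat.card β : ℝ) ≠ 0 := by
    have : 0 < Nat.card β := Nat.card_pos
    positivity
  push_cast
  rw [mul_div_mul_right _ _ this]

lemma pdens_triple {α X : Type} [Finite α] [Finite X] (P : α × X → Prop) :
    (pdens P) ^ 3 ≤ pdens (fun x : α × (Fin 3 → X) => ∀ j, P (x.1, x.2 j)) := by
  classical
  have := Fintype.ofFinite α
  have := Fintype.ofFinite X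
  have e1 : {x : α × X // P x} ≃ (a : α) × {x : X // P (a, x)} :=
    { toFun := fun x => ⟨x.1.1, x.1.2, x.2⟩
      invFun := fun x => ⟨(x.1, x.2.1), x.2.2⟩
      left_inv := fun x => rfl
      right_inv := fun x => rfl }
  have e2 : {x : α × (Fin 3 → X) // ∀ j, P (x.1, x.2 j)} ≃
      (a : α) × (Fin 3 → {x : X // P (a, x)}) :=
    { toFun := fun x => ⟨x.1.1, fun j => ⟨x.1.2 j, x.2 j⟩⟩
      invFun := fun x => ⟨(x.1, fun j => (x.2 j).1), fun j => (x.2 j).2⟩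
      left_inv := fun x => rfl
      right_inv := fun x => rfl }
  have c1 : Nat.card {x : α × X // P x} = ∑ a : α, Nat.card {x : X // P (a, x)} := by
    rw [Nat.card_congr e1, Nat.card_sigma]
  have c2 : Nat.card {x : α × (Fin 3 → X) // ∀ j, P (x.1, x.2 j)} =
      ∑ a : α, Nat.card {x : X // P (a, x)} ^ 3 := by
    rw [Nat.card_congr e2, Nat.card_sigma]
    refine Finset.sum_congr rfl fun a _ => ?_
    rw [Nat.card_fun]; simp
  unfold pdens
  rw [c1, c2, Nat.card_prod, Nat.card_prod, Nat.card_fun]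
  have key := pow_sum_div_card_le_sum_pow (s := (Finset.univ : Finset α))
    (f := fun a => (Nat.card {x : X // P (a, x)} : ℝ)) (fun _ _ => by positivity) 2
  push_cast
  simp only [Nat.card_eq_fintype_card (α := α), Nat.card_eq_fintype_card (α := Fin 3),
    Fintype.card_fin, Finset.card_univ] at key ⊢
  rw [div_pow]
  rcases Nat.eq_zero_or_pos (Fintype.card α) with h0 | h0
  · simp [h0]
  rcases Nat.eq_zero_or_pos (Nat.card X) with h1 | h1
  · rw [h1]; simp
  have h0' : (0 : ℝ) < Fintype.card α := by exact_mod_cast h0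
  have h1' : (0 : ℝ) < Nat.card X := by exact_mod_cast h1
  rw [div_le_iff₀ (by positivity)] at key
  rw [div_le_div_iff₀ (by positivity) (by positivity)]
  have := mul_le_mul_of_nonneg_right key
    (show (0 : ℝ) ≤ (Fintype.card α : ℝ) * (Nat.card X : ℝ) ^ 3 by positivity)
  refine this.trans (le_of_eq ?_)
  ring

/-- non-dependent version of `Fin.cons` -/
def fcons {k : ℕ} {X : Type} (x : X) (p : Fin k → X) : Fin (k + 1) → X := Fin.cons x p

lemma fcons_self {k : ℕ} {X : Type} (p : Fin (k + 1) → X) : fcons (p 0) (Fin.tail p) = p :=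
  Fin.cons_self_tail p

lemma blowup_fin (k : ℕ) : ∀ (Ω X : Type) [Finite Ω] [Finite X] (P : Ω × (Fin k → X) → Prop),
    (pdens P) ^ (3 ^ k) ≤ pdens (fun x : Ω × (Fin k → Fin 3 → X) =>
      ∀ h : Fin k → Fin 3, P (x.1, fun i => x.2 i (h i))) := by
  induction k with
  | zero =>
    intro Ω X _ _ P
    rw [pow_zero, pow_one]
    refine le_of_eq (pdens_congr (Equiv.prodCongr (Equiv.refl Ω) (Equiv.ofUnique _ _)) ?_)
    rintro ⟨a, p⟩
    simp only [Equiv.prodCongr_apply, Prod.map_apply, Equiv.refl_apply]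
    constructor
    · intro hp h
      convert hp using 2
    · intro hp
      convert hp finZeroElim using 2
  | succ k ih =>
    intro Ω X _ _ P
    have e1 : pdens P = pdens (fun x : (Ω × X) × (Fin k → X) => P (x.1.1, fcons x.1.2 x.2)) := by
      symm
      refine pdens_congr ⟨fun x => (x.1.1, fcons x.1.2 x.2),
        fun x => ((x.1, x.2 0), Fin.tail x.2), fun x => rfl, fun x => ?_⟩ (fun a => Iff.rfl)
      exact Prod.ext rfl (fcons_self _)
    have h1 := ih (Ω × X) X (fun x => P (x.1.1, fcons x.1.2 x.2))
    rw [← e1] at h1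
    have e2 : pdens (fun x : (Ω × X) × (Fin k → Fin 3 → X) =>
        ∀ h : Fin k → Fin 3, P (x.1.1, fcons x.1.2 (fun i => x.2 i (h i)))) =
      pdens (fun x : (Ω × (Fin k → Fin 3 → X)) × X =>
        ∀ h : Fin k → Fin 3, P (x.1.1, fcons x.2 (fun i => x.1.2 i (h i)))) :=
      pdens_congr ⟨fun x => ((x.1.1, x.2), x.1.2), fun x => ((x.1.1, x.2), x.1.2),
        fun x => rfl, fun x => rfl⟩ (fun a => Iff.rfl)
    have h2 := pdens_triple (fun x : (Ω × (Fin k → Fin 3 → X)) × X =>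
        ∀ h : Fin k → Fin 3, P (x.1.1, fcons x.2 (fun i => x.1.2 i (h i))))
    rw [← e2] at h2
    rw [pow_succ, pow_mul]
    refine (pow_le_pow_left₀ (pow_nonneg (pdens_nonneg _) _) h1 3).trans (h2.trans (le_of_eq ?_))
    refine pdens_congr ⟨fun x => (x.1.1, fcons x.2 x.1.2),
        fun x => ((x.1, Fin.tail x.2), x.2 0), fun x => rfl, fun x => ?_⟩ ?_
    · exact Prod.ext rfl (fcons_self _)
    · rintro ⟨⟨a, q⟩, x⟩
      constructor
      · intro H h
        convert H (h 0) (fun i => h i.succ) using 2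
        · rfl
        funext i
        refine Fin.cases ?_ (fun i => ?_) i <;> rfl
      · intro H j h
        convert H (fcons j h) using 2
        · rfl
        funext i
        refine Fin.cases ?_ (fun i => ?_) i <;> rfl

lemma blowup (ι : Type) [Fintype ι] (Ω X : Type) [Finite Ω] [Finite X]
    (P : Ω × (ι → X) → Prop) :
    (pdens P) ^ (3 ^ Fintype.card ι) ≤ pdens (fun x : Ω × (ι → Fin 3 → X) =>
      ∀ h : ι → Fin 3, P (x.1, fun i => x.2 i (h i))) := by
  let e := Fintype.equivFin ι
  have h := blowup_fin (Fintype.card ι) Ω X (fun x => P (x.1, fun i => x.2 (e i)))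
  have e1 : pdens (fun x : Ω × (Fin (Fintype.card ι) → X) => P (x.1, fun i => x.2 (e i))) =
      pdens P := by
    refine pdens_congr (Equiv.prodCongr (Equiv.refl Ω) (Equiv.arrowCongr e.symm (Equiv.refl X))) ?_
    rintro ⟨a, p⟩
    exact Iff.rfl
  rw [e1] at h
  refine h.trans (le_of_eq ?_)
  refine pdens_congr (Equiv.prodCongr (Equiv.refl Ω) (Equiv.arrowCongr e.symm (Equiv.refl _))) ?_
  rintro ⟨a, p⟩
  constructor
  · intro H g
    have := H (fun i => g (e.symm i))
    simpa [Equiv.arrowCongr] using this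
  · intro H g
    have := H (fun i => g (e i))
    simpa [Equiv.arrowCongr] using this

lemma noninj_card (ι X : Type) [Fintype ι] [Fintype X] :
    Nat.card {q : ι → X // ¬ Function.Injective q} * Nat.card X ≤
      Fintype.card ι ^ 2 * Nat.card (ι → X) := by
  classical
  have h1 : ∀ a b : ι, a ≠ b →
      (Finset.univ.filter fun q : ι → X => q a = q b).card * Fintype.card X ≤
        Fintype.card (ι → X) := by
    intro a b hab
    rw [← Finset.card_univ (α := X), ← Finset.card_product, ← Finset.card_univ]
    refine Finset.card_le_card_of_injOn (fun z => Function.update z.1 b z.2)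
      (fun _ _ => Finset.mem_coe.2 (Finset.mem_univ _)) ?_
    rintro ⟨q, x⟩ hq ⟨q', x'⟩ hq' hh
    simp only [Finset.coe_product, Set.mem_prod, Finset.mem_coe, Finset.mem_filter,
      Finset.mem_univ, true_and, and_true] at hq hq'
    have hh : Function.update q b x = Function.update q' b x' := hh
    have hx : x = x' := by simpa using congrFun hh b
    have hqq : ∀ i, i ≠ b → q i = q' i := fun i hi => by simpa [hi] using congrFun hh i
    refine Prod.ext (funext fun i => ?_) hx
    by_cases hi : i = b
    · subst hi
      simp only
      rw [← hq, ← hq']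
      exact hqq a hab
    · exact hqq i hi
  have h2 : (Finset.univ.filter fun q : ι → X => ¬ Function.Injective q) ⊆
      (Finset.univ : Finset ι).offDiag.biUnion
        (fun z => Finset.univ.filter fun q : ι → X => q z.1 = q z.2) := by
    intro q hq
    simp only [Finset.mem_filter, Finset.mem_univ, true_and] at hq
    simp only [Function.Injective, not_forall] at hq
    obtain ⟨a, b, h, hab⟩ := hq
    simp only [Finset.mem_biUnion, Finset.mem_filter, Finset.mem_univ, true_and]
    exact ⟨(a, b), by simp [hab], h⟩
  rw [Nat.card_eq_fintype_card, Nat.card_eq_fintype_card, Nat.card_eq_fintype_card,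
    Fintype.card_subtype]
  calc _ ≤ (∑ z ∈ (Finset.univ : Finset ι).offDiag,
        (Finset.univ.filter fun q : ι → X => q z.1 = q z.2).card) * Fintype.card X :=
        Nat.mul_le_mul_right _ ((Finset.card_le_card h2).trans Finset.card_biUnion_le)
    _ ≤ ∑ z ∈ (Finset.univ : Finset ι).offDiag, Fintype.card (ι → X) := by
        rw [Finset.sum_mul]
        refine Finset.sum_le_sum fun z hz => h1 _ _ ?_
        simpa using hz
    _ ≤ _ := by
        rw [Finset.sum_const, smul_eq_mul]
        refine Nat.mul_le_mul_right _ ?_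
        rw [Finset.offDiag_card, Finset.card_univ, sq]
        exact Nat.sub_le _ _

lemma exists_inj (ι Ω X : Type) [Fintype ι] [Finite Ω] [Fintype X] [Nonempty X]
    (P : Ω × (ι → X) → Prop)
    (h : (Fintype.card ι : ℝ) ^ 2 < pdens P * Fintype.card X) :
    ∃ w q, Function.Injective q ∧ P (w, q) := by
  by_contra hcon
  push Not at hcon
  have hle : Nat.card {x // P x} ≤ Nat.card (Ω × {q : ι → X // ¬ Function.Injective q}) := by
    refine Nat.card_le_card_of_injective
      (fun x => (x.1.1, ⟨x.1.2, fun hi => hcon x.1.1 x.1.2 hi x.2⟩)) ?_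
    rintro ⟨⟨a, q⟩, hx⟩ ⟨⟨a', q'⟩, hx'⟩ hh
    simpa using hh
  rw [Nat.card_prod] at hle
  have h2 := noninj_card ι X
  have hX : 0 < Nat.card (ι → X) := Nat.card_pos
  rcases Nat.eq_zero_or_pos (Nat.card Ω) with h0 | h0
  · have : pdens P = 0 := by
      unfold pdens
      rw [Nat.card_prod, h0]; simp
    rw [this] at h
    have := sq_nonneg (Fintype.card ι : ℝ)
    linarith
  have h3 : Nat.card {x // P x} * Fintype.card X ≤
      Fintype.card ι ^ 2 * (Nat.card Ω * Nat.card (ι → X)) := by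
    rw [← Nat.card_eq_fintype_card (α := X)]
    calc _ ≤ (Nat.card Ω * Nat.card {q : ι → X // ¬ Function.Injective q}) * Nat.card X :=
          Nat.mul_le_mul_right _ hle
      _ = Nat.card Ω * (Nat.card {q : ι → X // ¬ Function.Injective q} * Nat.card X) := by ring
      _ ≤ Nat.card Ω * (Fintype.card ι ^ 2 * Nat.card (ι → X)) := Nat.mul_le_mul_left _ h2
      _ = _ := by ring
  have h4 : (Nat.card {x // P x} : ℝ) * Fintype.card X ≤
      (Fintype.card ι : ℝ) ^ 2 * ((Nat.card Ω : ℝ) * Nat.card (ι → X)) := by exact_mod_cast h3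
  unfold pdens at h
  rw [Nat.card_prod, div_mul_eq_mul_div, lt_div_iff₀ (by positivity)] at h
  push_cast at h
  linarith

lemma pdens_shift {V Y : Type} [AddCommGroup V] (f : Y → V) (P : V × Y → Prop) :
    pdens (fun x : V × Y => P (x.1 + f x.2, x.2)) = pdens P :=
  pdens_congr ⟨fun x => (x.1 + f x.2, x.2), fun x => (x.1 - f x.2, x.2),
    fun x => by simp, fun x => by simp⟩ (fun _ => Iff.rfl)

/-- complete multipartite patterns -/
lemma comb_one (κ : Type) [Fintype κ] (V X : Type) [Finite V] [AddCommGroup V] [Fintype X]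
    [Nonempty X] (e : X → V) (S : V → Prop)
    (h : ((Fintype.card κ * 3 : ℕ) : ℝ) ^ 2 < pdens S ^ (3 ^ Fintype.card κ) * Fintype.card X) :
    ∃ (u : V) (c : κ → Fin 3 → X), Function.Injective (fun z : κ × Fin 3 => c z.1 z.2) ∧
      ∀ g : κ → Fin 3, S (u + ∑ i, e (c i (g i))) := by
  have h0 : pdens (fun x : V × (κ → X) => S (x.1 + ∑ i, e (x.2 i))) = pdens S := by
    rw [pdens_shift (fun p : κ → X => ∑ i, e (p i)) (fun x => S x.1), pdens_fst]
  have h1 := blowup κ V X (fun x : V × (κ → X) => S (x.1 + ∑ i, e (x.2 i)))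
  rw [h0] at h1
  have h2 := pdens_congr (Equiv.prodCongr (Equiv.refl V) (Equiv.curry κ (Fin 3) X))
    (P := fun x => ∀ g : κ → Fin 3, S (x.1 + ∑ i, e (x.2 (i, g i))))
    (Q := fun x : V × (κ → Fin 3 → X) => ∀ g : κ → Fin 3, S (x.1 + ∑ i, e (x.2 i (g i))))
    (fun a => Iff.rfl)
  rw [← h2] at h1
  obtain ⟨u, q, hq, hS⟩ := exists_inj (κ × Fin 3) V X _ (lt_of_lt_of_le (by simpa using h)
    (mul_le_mul_of_nonneg_right h1 (Nat.cast_nonneg _)))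
  exact ⟨u, fun i j => q (i, j), hq, hS⟩

/-- blown-up products of triangles -/
lemma comb_two (μ : Type) [Fintype μ] (V X : Type) [Finite V] [AddCommGroup V] [Fintype X]
    [Nonempty X] (e : X → V) (S : V → Prop)
    (h : ((Fintype.card μ * 3 * 3 : ℕ) : ℝ) ^ 2 <
      (pdens S ^ (3 ^ Fintype.card μ)) ^ (3 ^ (Fintype.card μ * 3)) * Fintype.card X) :
    ∃ (u : V) (c : μ → Fin 3 → Fin 3 → X),
      Function.Injective (fun z : (μ × Fin 3) × Fin 3 => c z.1.1 z.1.2 z.2) ∧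
      ∀ (g : μ → Fin 3) (l : μ → Fin 3 → Fin 3),
        S (u + ∑ i, (∑ j, e (c i j (l i j)) - e (c i (g i) (l i (g i))))) := by
  have h0 : pdens (fun x : V × (μ → X) => S (x.1 + -∑ i, e (x.2 i))) = pdens S := by
    rw [pdens_shift (fun p : μ → X => -∑ i, e (p i)) (fun x => S x.1), pdens_fst]
  have h1 := blowup μ V X (fun x : V × (μ → X) => S (x.1 + -∑ i, e (x.2 i)))
  rw [h0] at h1
  have h2 := pdens_congr (Equiv.prodCongr (Equiv.refl V) (Equiv.curry μ (Fin 3) X))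
    (P := fun x => ∀ g : μ → Fin 3, S (x.1 + -∑ i, e (x.2 (i, g i))))
    (Q := fun x : V × (μ → Fin 3 → X) => ∀ g : μ → Fin 3, S (x.1 + -∑ i, e (x.2 i (g i))))
    (fun a => Iff.rfl)
  rw [← h2, ← pdens_shift (fun p : μ × Fin 3 → X => ∑ i, ∑ j, e (p (i, j)))] at h1
  have h4 := (pow_le_pow_left₀ (pow_nonneg (pdens_nonneg _) _) h1 _).trans
    (blowup (μ × Fin 3) V X _)
  rw [← pdens_congr (Equiv.prodCongr (Equiv.refl V) (Equiv.curry (μ × Fin 3) (Fin 3) X))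
    (fun a => Iff.rfl)] at h4
  obtain ⟨u, q, hq, hS⟩ := exists_inj ((μ × Fin 3) × Fin 3) V X _ (lt_of_lt_of_le
    (by simpa using h) (mul_le_mul_of_nonneg_right h4 (Nat.cast_nonneg _)))
  refine ⟨u, fun i j l => q ((i, j), l), hq, fun g l => ?_⟩
  have := hS (fun z => l z.1 z.2) g
  convert this using 1
  rw [Finset.sum_sub_distrib]
  simp [Equiv.curry, Function.curry, sub_eq_add_neg, add_assoc]

/-- `ZMod 2` and `Bool` -/
def zbEquiv : ZMod 2 ≃ Bool where
  toFun z := decide (z = 1)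
  invFun b := if b then 1 else 0
  left_inv := by decide
  right_inv := by decide

/-- identification of vertices with vectors over `ZMod 2` -/
def toB (n : ℕ) : (Fin n → ZMod 2) ≃ (Fin n → Bool) := Equiv.arrowCongr (Equiv.refl _) zbEquiv

lemma toB_apply {n : ℕ} (v : Fin n → ZMod 2) (a : Fin n) : toB n v a = zbEquiv (v a) := rfl

lemma pdens_toB {n : ℕ} (S : Finset (Fin n → Bool)) :
    pdens (fun v : Fin n → ZMod 2 => toB n v ∈ S) = (S.card : ℝ) / 2 ^ n := by
  rw [pdens_equiv (toB n) (fun x => x ∈ S)]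
  unfold pdens
  simp

/-- the embedding with base point `u` and directions `c` -/
def cubeMap {d n : ℕ} (u : Fin n → ZMod 2) (c : Fin d → Fin n) (x : Fin d → Bool) :
    Fin n → Bool :=
  toB n (u + ∑ j, if x j then Pi.single (c j) 1 else 0)

lemma cubeMap_dist {d n : ℕ} (u : Fin n → ZMod 2) (c : Fin d → Fin n)
    (hc : Function.Injective c) (x y : Fin d → Bool) :
    hammingDist (cubeMap u c x) (cubeMap u c y) = hammingDist x y := by
  classical
  have hin : ∀ (x : Fin d → Bool) (j : Fin d),
      (∑ j, if x j then (Pi.single (c j) 1 : Fin n → ZMod 2) else 0) (c j) =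
        if x j then 1 else 0 := by
    intro x j
    rw [Finset.sum_apply, Finset.sum_eq_single j]
    · split_ifs <;> simp
    · intro b _ hb
      split_ifs
      · rw [Pi.single_eq_of_ne]
        exact fun h => hb (hc h).symm
      · rfl
    · simp
  have hout : ∀ (x : Fin d → Bool) (a : Fin n), a ∉ Set.range c →
      (∑ j, if x j then (Pi.single (c j) 1 : Fin n → ZMod 2) else 0) a = 0 := by
    intro x a ha
    rw [Finset.sum_apply]
    refine Finset.sum_eq_zero fun b _ => ?_
    split_ifs
    · rw [Pi.single_eq_of_ne]
      exact fun h => ha ⟨b, h.symm⟩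
    · rfl
  unfold hammingDist
  rw [← Finset.card_map ⟨c, hc⟩]
  congr 1
  ext a
  simp only [Finset.mem_filter, Finset.mem_univ, true_and, Finset.mem_map,
    Function.Embedding.coeFn_mk, cubeMap, toB_apply, ne_eq, zbEquiv.injective.eq_iff,
    Pi.add_apply, add_right_inj]
  constructor
  · intro h
    by_cases ha : a ∈ Set.range c
    · obtain ⟨j, rfl⟩ := ha
      refine ⟨j, fun hj => h ?_, rfl⟩
      rw [hin, hin, hj]
    · exact absurd (by rw [hout _ _ ha, hout _ _ ha]) h
  · rintro ⟨j, hj, rfl⟩ h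
    rw [hin, hin] at h
    apply hj
    revert h
    cases x j <;> cases y j <;> simp

lemma cubeMap_embedding {d n : ℕ} (u : Fin n → ZMod 2) (c : Fin d → Fin n)
    (hc : Function.Injective c) : IsCubeEmbedding (cubeMap u c) := by
  refine ⟨fun x y h => ?_, fun x y h => ?_⟩
  · rw [← hammingDist_eq_zero, ← cubeMap_dist u c hc, hammingDist_eq_zero]
    exact h
  · rw [cubeMap_dist u c hc, h]

lemma count_points {κ : Type} [Fintype κ] {n d : ℕ} (S : Finset (Fin n → Bool)) (s : κ → ℕ)
    (hs2 : ∀ i, 2 ≤ s i) (hs3 : ∀ i, s i ≤ 3) (hd : ∑ i, s i = d)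
    (u : Fin n → ZMod 2) (c : κ → Fin 3 → Fin n)
    (hc : Function.Injective (fun z : κ × Fin 3 => c z.1 z.2))
    (hT : ∀ g : κ → Fin 3, toB n (u + ∑ i, Pi.single (c i (g i)) 1) ∈ S)
    (b : ℕ)
    (hb : b = 0 ∨ (b = 1 ∧ ∃ D : Finset κ, D.Nonempty ∧
      toB n (u + ∑ i ∈ D, (Pi.single (c i 0) 1 + Pi.single (c i 1) 1)) ∈ S)) :
    ∃ i : (Fin d → Bool) → (Fin n → Bool), IsCubeEmbedding i ∧
      ∃ F : Finset (Fin d → Bool), b + ∏ i, s i ≤ F.card ∧ ∀ x ∈ F, i x ∈ S := by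
  classical
  have hcard : Fintype.card (Σ i, Fin (s i)) = d := by simp [hd]
  let φ : Fin d ≃ Σ i, Fin (s i) := (Fintype.equivFinOfCardEq hcard).symm
  let c' : Fin d → Fin n := fun j => c (φ j).1 (Fin.castLE (hs3 _) (φ j).2)
  have hc' : Function.Injective c' := by
    intro j j' h
    have h2 := @hc ((φ j).1, Fin.castLE (hs3 _) (φ j).2) ((φ j').1, Fin.castLE (hs3 _) (φ j').2) h
    apply φ.injective
    revert h2
    generalize φ j = p
    generalize φ j' = p'
    obtain ⟨a, b⟩ := p
    obtain ⟨a', b'⟩ := p'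
    intro h2
    simp only [Prod.mk.injEq] at h2
    obtain ⟨rfl, h3⟩ := h2
    have : b = b' := by simpa using h3
    rw [this]
  -- transversals
  let pt : (∀ i, Fin (s i)) → (Fin d → Bool) := fun h j => decide (h (φ j).1 = (φ j).2)
  have hsum : ∀ (p : (Σ i, Fin (s i)) → Bool),
      (∑ j, if p (φ j) then (Pi.single (c' j) 1 : Fin n → ZMod 2) else 0) =
      ∑ i, ∑ l : Fin (s i), if p ⟨i, l⟩ then
        (Pi.single (c i (Fin.castLE (hs3 i) l)) 1 : Fin n → ZMod 2) else 0 := by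
    intro p
    rw [Equiv.sum_comp φ (fun z : (Σ i, Fin (s i)) => if p z then
        (Pi.single (c z.1 (Fin.castLE (hs3 z.1) z.2)) 1 : Fin n → ZMod 2) else 0)]
    rw [← Finset.univ_sigma_univ, Finset.sum_sigma]
  have hpt : ∀ h, cubeMap u c' (pt h) ∈ S := by
    intro h
    have := hT (fun i => Fin.castLE (hs3 i) (h i))
    unfold cubeMap
    convert this using 3
    rw [hsum (fun z => decide (h z.1 = z.2))]
    refine Finset.sum_congr rfl fun i _ => ?_
    simp
  have hinj : Function.Injective pt := by
    intro h h' hh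
    funext i
    have := congrFun hh (φ.symm ⟨i, h i⟩)
    have hev : ∀ g : ∀ i, Fin (s i), ∀ z, pt g (φ.symm z) = decide (g z.1 = z.2) := by
      intro g z
      simp only [pt]
      rw [Equiv.apply_symm_apply]
    rw [hev, hev] at this
    exact (by simpa using this.symm : h' i = h i).symm
  refine ⟨cubeMap u c', cubeMap_embedding u c' hc',
    Finset.univ.filter (fun x => cubeMap u c' x ∈ S), ?_, fun x hx => (Finset.mem_filter.1 hx).2⟩
  have him : (Finset.univ.image pt).card = ∏ i, s i := by
    rw [Finset.card_image_of_injective _ hinj, Finset.card_univ, Fintype.card_pi]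
    simp
  rcases hb with rfl | ⟨rfl, D, ⟨i₀, hi₀⟩, hD⟩
  · rw [zero_add, ← him]
    refine Finset.card_le_card fun x hx => ?_
    obtain ⟨h, -, rfl⟩ := Finset.mem_image.1 hx
    exact Finset.mem_filter.2 ⟨Finset.mem_univ _, hpt h⟩
  · let q : (Σ i, Fin (s i)) → Bool := fun z => decide (z.1 ∈ D ∧ (z.2 : ℕ) < 2)
    have hq : cubeMap u c' (fun j => q (φ j)) ∈ S := by
      unfold cubeMap
      convert hD using 3
      rw [hsum q, ← Finset.sum_filter_add_sum_filter_not Finset.univ (fun i => i ∈ D)]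
      rw [Finset.sum_eq_zero (s := Finset.univ.filter fun i => i ∉ D), add_zero,
        Finset.filter_mem_eq_inter, Finset.univ_inter]
      · refine Finset.sum_congr rfl fun i hi => ?_
        simp only [q, hi, true_and, decide_eq_true_eq]
        have h2 := hs2 i
        have h3 := hs3 i
        have : ∀ (m : ℕ) (hm : m ≤ 3), 2 ≤ m →
          (∑ l : Fin m, if (l : ℕ) < 2 then
            (Pi.single (c i (Fin.castLE hm l)) 1 : Fin n → ZMod 2) else 0) =
            Pi.single (c i 0) 1 + Pi.single (c i 1) 1 := by
          intro m hm hm2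
          obtain rfl | rfl : m = 2 ∨ m = 3 := by omega
          · rw [Fin.sum_univ_two]; rfl
          · rw [Fin.sum_univ_three]
            simp
        exact this _ h3 h2
      · intro i hi
        refine Finset.sum_eq_zero fun l _ => ?_
        have : i ∉ D := by simpa using hi
        simp [q, this]
    have hne : (fun j => q (φ j)) ∉ Finset.univ.image pt := by
      intro hmem
      obtain ⟨h, -, hh⟩ := Finset.mem_image.1 hmem
      have h2 := hs2 i₀
      have hev : ∀ z, pt h (φ.symm z) = decide (h z.1 = z.2) := by
        intro z
        simp only [pt]
        rw [Equiv.apply_symm_apply]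
      have e0 := congrFun hh (φ.symm ⟨i₀, ⟨0, by omega⟩⟩)
      have e1 := congrFun hh (φ.symm ⟨i₀, ⟨1, by omega⟩⟩)
      rw [hev] at e0 e1
      simp only [q, Equiv.apply_symm_apply, hi₀, true_and] at e0 e1
      have f0 : h i₀ = ⟨0, by omega⟩ := by simpa using e0
      have f1 : h i₀ = ⟨1, by omega⟩ := by simpa using e1
      rw [f0] at f1
      simp at f1
    rw [← him, add_comm, ← Finset.card_insert_of_notMem hne]
    refine Finset.card_le_card fun x hx => ?_
    refine Finset.mem_filter.2 ⟨Finset.mem_univ _, ?_⟩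
    rcases Finset.mem_insert.1 hx with rfl | hx
    · exact hq
    · obtain ⟨h, -, rfl⟩ := Finset.mem_image.1 hx
      exact hpt h

lemma exists_sizes (d : ℕ) (hd : 2 ≤ d) (κ : Type) [Fintype κ]
    (hκ : Fintype.card κ = (d + 2) / 3) :
    ∃ s : κ → ℕ, (∀ i, 2 ≤ s i) ∧ (∀ i, s i ≤ 3) ∧ ∑ i, s i = d ∧ ∏ i, s i = t3 d := by
  classical
  obtain ⟨R, -, hR⟩ := Finset.exists_subset_card_eq (s := (Finset.univ : Finset κ))
    (n := 3 * ((d + 2) / 3) - d) (by rw [Finset.card_univ]; omega)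
  have hRc : (Finset.univ.filter fun i => i ∉ R).card = (d + 2) / 3 - (3 * ((d + 2) / 3) - d) := by
    have : (Finset.univ.filter fun i => i ∉ R) = Rᶜ := by ext; simp
    rw [this, Finset.card_compl, hR, hκ]
  refine ⟨fun i => if i ∈ R then 2 else 3, fun i => ?_, fun i => ?_, ?_, ?_⟩
  · dsimp only; split_ifs <;> omega
  · dsimp only; split_ifs <;> omega
  · rw [Finset.sum_ite, Finset.sum_const, Finset.sum_const, hRc, Finset.filter_mem_eq_inter,
      Finset.univ_inter, hR]
    simp only [smul_eq_mul]
    omega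
  · rw [Finset.prod_ite, Finset.prod_const, Finset.prod_const, hRc, Finset.filter_mem_eq_inter,
      Finset.univ_inter, hR]
    unfold t3
    split_ifs with h0 h1
    · rw [show 3 * ((d + 2) / 3) - d = 0 by omega, show (d + 2) / 3 - 0 = d / 3 by omega]
      simp
    · rw [show 3 * ((d + 2) / 3) - d = 2 by omega, show (d + 2) / 3 - 2 = (d - 4) / 3 by omega]
      norm_num
    · rw [show 3 * ((d + 2) / 3) - d = 1 by omega, show (d + 2) / 3 - 1 = (d - 2) / 3 by omega]
      norm_num

lemma even_structure (m : ℕ) (V X : Type) [Finite V] [AddCommGroup V] [Fintype X]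
    [Nonempty X] (e : X → V) (S : V → Prop)
    (h : ((m * 3 * 3 : ℕ) : ℝ) ^ 2 <
      (pdens S ^ (3 ^ m)) ^ (3 ^ (m * 3)) * Fintype.card X) :
    ∃ (u : V) (c : Fin m ⊕ Fin m → Fin 3 → X),
      Function.Injective (fun z : (Fin m ⊕ Fin m) × Fin 3 => c z.1 z.2) ∧
      (∀ g : Fin m ⊕ Fin m → Fin 3, S (u + ∑ i, e (c i (g i)))) ∧
      S (u + ∑ i ∈ Finset.univ.map (Function.Embedding.inl (α := Fin m) (β := Fin m)),
        (e (c i 0) + e (c i 1))) := by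
  obtain ⟨u, c, hc, hS⟩ := comb_two (Fin m) V X e S (by simpa using h)
  let A : Fin 3 → Fin 3 := ![0, 1, 0]
  let B : Fin 3 → Fin 3 := ![0, 0, 1]
  let G : Fin 3 → Fin 3 := ![1, 0, 1]
  let c' : Fin m ⊕ Fin m → Fin 3 → X :=
    Sum.elim (fun i j => c i (A j) (B j)) (fun i j => c i 2 j)
  refine ⟨u, c', ?_, ?_, ?_⟩
  · have hfac : (fun z : (Fin m ⊕ Fin m) × Fin 3 => c' z.1 z.2) =
        (fun z : (Fin m × Fin 3) × Fin 3 => c z.1.1 z.1.2 z.2) ∘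
        (fun z => Sum.elim (fun i => ((i, A z.2), B z.2)) (fun i => ((i, 2), z.2)) z.1) := by
      funext ⟨z, j⟩
      rcases z with i | i <;> rfl
    rw [hfac]
    refine hc.comp ?_
    have hAB : ∀ j j', A j = A j' → B j = B j' → j = j' := by decide
    have hA2 : ∀ j, A j ≠ 2 := by decide
    rintro ⟨i | i, j⟩ ⟨i' | i', j'⟩ hh
    · simp only [Sum.elim_inl, Prod.mk.injEq] at hh
      obtain ⟨⟨rfl, h1⟩, h2⟩ := hh
      rw [hAB j j' h1 h2]
    · simp only [Sum.elim_inl, Sum.elim_inr, Prod.mk.injEq] at hh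
      exact absurd hh.1.2 (hA2 _)
    · simp only [Sum.elim_inl, Sum.elim_inr, Prod.mk.injEq] at hh
      exact absurd hh.1.2.symm (hA2 _)
    · simp only [Sum.elim_inr, Prod.mk.injEq] at hh
      obtain ⟨⟨rfl, -⟩, rfl⟩ := hh
      rfl
  · intro g
    have := hS (fun i => G (g (Sum.inl i)))
      (fun i j => if j = 2 then g (Sum.inr i) else B (g (Sum.inl i)))
    convert this using 2
    rw [Fintype.sum_sum_type, ← Finset.sum_add_distrib]
    refine Finset.sum_congr rfl fun i _ => ?_
    simp only [c', Sum.elim_inl, Sum.elim_inr]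
    generalize g (Sum.inr i) = y
    generalize g (Sum.inl i) = x
    rw [Fin.sum_univ_three]
    fin_cases x <;> simp [A, B, G] <;> abel
  · have := hS (fun _ => 2) (fun _ _ => 0)
    convert this using 2
    rw [Finset.sum_map]
    refine Finset.sum_congr rfl fun i _ => ?_
    simp [Fin.sum_univ_three, c', A, B]

lemma eventually_large (ε : ℝ) (hε : 0 < ε) (a : ℝ) :
    ∀ᶠ n : ℕ in atTop, a < ε * n := by
  have : Tendsto (fun n : ℕ => ε * (n : ℝ)) atTop atTop :=
    Tendsto.const_mul_atTop hε tendsto_natCast_atTop_atTop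
  exact this.eventually_gt_atTop a

lemma main_eventually (d : ℕ) (hd : 2 ≤ d) (ε : ℝ) (hε : 0 < ε) :
    ∀ᶠ n : ℕ in atTop, ∀ S : Finset (Fin n → Bool), ε ≤ (S.card : ℝ) / 2 ^ n →
      ∃ i : (Fin d → Bool) → (Fin n → Bool), IsCubeEmbedding i ∧
        ∃ F : Finset (Fin d → Bool), t2 d + t3 d ≤ F.card ∧ ∀ x ∈ F, i x ∈ S := by
  by_cases hk : (d + 2) / 3 % 2 = 1
  · have ht : t2 d = 0 := if_pos hk
    obtain ⟨s, hs2, hs3, hsum, hprod⟩ := exists_sizes d hd (Fin ((d + 2) / 3)) (by simp)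
    filter_upwards [eventually_large (ε ^ (3 ^ ((d + 2) / 3))) (by positivity)
      ((((d + 2) / 3 * 3 : ℕ) : ℝ) ^ 2), eventually_gt_atTop 0] with n hn hn0 S hS
    have : Nonempty (Fin n) := ⟨⟨0, hn0⟩⟩
    have hp := pdens_toB S
    obtain ⟨u, c, hc, hT⟩ := comb_one (Fin ((d + 2) / 3)) (Fin n → ZMod 2) (Fin n)
      (fun a => Pi.single a 1) (fun v => toB n v ∈ S) (by
        rw [hp, Fintype.card_fin, Fintype.card_fin]
        exact hn.trans_le (by gcongr))
    have := count_points S s hs2 hs3 hsum u c hc hT 0 (Or.inl rfl)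
    rwa [ht, ← hprod]
  · have ht : t2 d = 1 := if_neg hk
    obtain ⟨m, hm⟩ : ∃ m, (d + 2) / 3 = m + m := ⟨(d + 2) / 3 / 2, by omega⟩
    have hm0 : 0 < m := by omega
    obtain ⟨s, hs2, hs3, hsum, hprod⟩ := exists_sizes d hd (Fin m ⊕ Fin m) (by simp [hm])
    filter_upwards [eventually_large ((ε ^ (3 ^ m)) ^ (3 ^ (m * 3))) (by positivity)
      (((m * 3 * 3 : ℕ) : ℝ) ^ 2), eventually_gt_atTop 0] with n hn hn0 S hS
    have : Nonempty (Fin n) := ⟨⟨0, hn0⟩⟩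
    have hp := pdens_toB S
    obtain ⟨u, c, hc, hT, hD⟩ := even_structure m (Fin n → ZMod 2) (Fin n)
      (fun a => Pi.single a 1) (fun v => toB n v ∈ S) (by
        rw [hp, Fintype.card_fin]
        exact hn.trans_le (by gcongr))
    have := count_points S s hs2 hs3 hsum u c hc hT 1 (Or.inr ⟨rfl, _,
      ⟨Sum.inl ⟨0, hm0⟩, by simp⟩, hD⟩)
    rwa [ht, ← hprod]

/-- For every d ≥ 2, λ(𝓕_{d, t₂(d)+t₃(d)}) = 0. -/
theorem lambda_Fdt_zero (d : ℕ) (hd : 2 ≤ d) :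
    Filter.Tendsto (fun n : ℕ => (excT n d (t2 d + t3 d) : ℝ) / 2 ^ n)
      Filter.atTop (𝓝 0) := by
  rw [Metric.tendsto_nhds]
  intro ε hε
  filter_upwards [main_eventually d hd ε hε] with n hn
  rw [Real.dist_eq, sub_zero, abs_of_nonneg (by positivity)]
  by_contra hcon
  push Not at hcon
  have hbdd : BddAbove {k : ℕ | ∃ S : Finset (Fin n → Bool),
      (∀ F : Set (Fin d → Bool), F.ncard = t2 d + t3 d → IsFree F (S : Set (Fin n → Bool))) ∧
        S.card = k} := by
    refine ⟨Fintype.card (Fin n → Bool), ?_⟩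
    rintro k ⟨S, -, rfl⟩
    exact Finset.card_le_univ S
  rcases Set.eq_empty_or_nonempty {k : ℕ | ∃ S : Finset (Fin n → Bool),
      (∀ F : Set (Fin d → Bool), F.ncard = t2 d + t3 d → IsFree F (S : Set (Fin n → Bool))) ∧
        S.card = k} with he | hne
  · have : excT n d (t2 d + t3 d) = 0 := by
      unfold excT
      rw [he, csSup_empty]; rfl
    rw [this] at hcon
    simp at hcon
    linarith
  · obtain ⟨S, hfree, hcard⟩ := Nat.sSup_mem hne hbdd
    have hc : S.card = excT n d (t2 d + t3 d) := hcard
    rw [← hc] at hcon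
    obtain ⟨i, hi, F, hF, hFS⟩ := hn S hcon
    obtain ⟨F', hF', hF'c⟩ := Finset.exists_subset_card_eq hF
    refine hfree (F' : Set (Fin d → Bool)) (by rw [Set.ncard_coe_finset, hF'c]) i hi ?_
    rintro _ ⟨x, hx, rfl⟩
    exact hFS x (hF' hx)
end
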